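/- arXiv:1502.04286 — 15 statements merged into one kernel-verified Lean document; each statement's English description precedes it below -/
import Mathlib

section
/- Let H be a real Hilbert space and A : H → Set H a monotone operator. Let x ∈ H with 0 ∉ A(x), let 0 < λ₁ < λ₂ be real numbers, and suppose y₁, y₂, v₁, v₂ ∈ H satisfy vᵢ ∈ A(yᵢ) and λᵢ·vᵢ + yᵢ − x = 0 for i = 1, 2. Then 0 < λ₁·‖x − y₁‖ < λ₂·‖x − y₂‖; that is, the function φ(λ, x) = λ‖x − J_λ x‖ is strictly increasing in λ on (0, ∞) and positive whenever 0 ∉ A(x). -/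
open RealInnerProductSpace

theorem stmt_1 {H : Type*} [NormedAddCommGroup H] [InnerProductSpace ℝ H] [CompleteSpace H]
    (A : H → Set H)
    (hA : ∀ u v a b : H, u ∈ A a → v ∈ A b → 0 ≤ ⟪u - v, a - b⟫)
    (x y₁ y₂ v₁ v₂ : H) (hx : 0 ∉ A x) (l₁ l₂ : ℝ) (hl₁ : 0 < l₁) (hl : l₁ < l₂)
    (hv₁ : v₁ ∈ A y₁) (hv₂ : v₂ ∈ A y₂)
    (he₁ : l₁ • v₁ + y₁ - x = 0) (he₂ : l₂ • v₂ + y₂ - x = 0) :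
    0 < l₁ * ‖x - y₁‖ ∧ l₁ * ‖x - y₁‖ < l₂ * ‖x - y₂‖ := by
  have hd₁ : x - y₁ = l₁ • v₁ := by rw [← sub_eq_zero, ← neg_eq_zero, ← he₁]; abel
  have hd₂ : x - y₂ = l₂ • v₂ := by rw [← sub_eq_zero, ← neg_eq_zero, ← he₂]; abel
  have hl₂ : 0 < l₂ := hl₁.trans hl
  have hpos : 0 < ‖v₁‖ := by
    rw [norm_pos_iff]
    rintro rfl
    rw [smul_zero, sub_eq_zero] at hd₁
    exact hx (hd₁ ▸ hv₁)
  have hmono := hA v₁ v₂ y₁ y₂ hv₁ hv₂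
  have hy : y₁ - y₂ = l₂ • v₂ - l₁ • v₁ := by rw [← hd₁, ← hd₂]; abel
  rw [hy] at hmono
  simp only [inner_sub_left, inner_sub_right, real_inner_smul_right,
    real_inner_self_eq_norm_sq, real_inner_comm v₁ v₂] at hmono
  have hcs := mul_le_mul_of_nonneg_left (real_inner_le_norm v₁ v₂) (add_pos hl₁ hl₂).le
  have hprod : 0 ≤ (‖v₁‖ - ‖v₂‖) * (l₂ * ‖v₂‖ - l₁ * ‖v₁‖) := by
    linarith
  have hle : l₁ * ‖v₁‖ ≤ l₂ * ‖v₂‖ := by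
    by_contra! h
    have hv : ‖v₁‖ ≤ ‖v₂‖ := by
      by_contra! h'
      nlinarith
    nlinarith [norm_nonneg v₂]
  rw [hd₁, hd₂, norm_smul, norm_smul, Real.norm_of_nonneg hl₁.le, Real.norm_of_nonneg hl₂.le]
  have hp : 0 < l₁ * ‖v₁‖ := mul_pos hl₁ hpos
  exact ⟨mul_pos hl₁ hp, mul_lt_mul hl hle hp hl₂.le⟩
end

section
/- Let H be a real Hilbert space, A : H → Set H a monotone operator, J : ℝ → H → H a resolvent family for A, and θ > 0. Define Γ_θ : H → ℝ by Γ_θ(x) = inf { α ∈ ℝ | α > 0 and ‖x − J(α⁻¹)(x)‖ ≤ α·θ }. Then Γ_θ is Lipschitz continuous with constant 1/θ: for all x, y ∈ H, |Γ_θ(x) − Γ_θ(y)| ≤ ‖x − y‖/θ. -/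
open RealInnerProductSpace

section Resolvent

variable {H : Type*} [NormedAddCommGroup H] [InnerProductSpace ℝ H]

theorem norm_le_norm_of_inner_sub_nonneg {p d : H} (h : 0 ≤ ⟪p, d - p⟫) : ‖p‖ ≤ ‖d‖ := by
  rw [inner_sub_right, real_inner_self_eq_norm_sq] at h
  have := real_inner_le_norm p d
  by_contra! hlt
  nlinarith [norm_nonneg p, norm_nonneg d]

/-- If `J` is a resolvent of a monotone operator at parameter `l`, then `z ↦ z - J l z` is
nonexpansive. -/
theorem norm_sub_resolvent_sub_le {A : H → Set H}
    (hA : ∀ u v a b : H, u ∈ A a → v ∈ A b → 0 ≤ ⟪u - v, a - b⟫) {J : ℝ → H → H}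
    (hJ : ∀ l : ℝ, 0 < l → ∀ z : H, ∃ v ∈ A (J l z), z - J l z = l • v)
    {l : ℝ} (hl : 0 < l) (x y : H) : ‖(x - J l x) - (y - J l y)‖ ≤ ‖x - y‖ := by
  obtain ⟨v, hv, hxv⟩ := hJ l hl x
  obtain ⟨w, hw, hyw⟩ := hJ l hl y
  apply norm_le_norm_of_inner_sub_nonneg
  have h : (x - y) - ((x - J l x) - (y - J l y)) = J l x - J l y := by abel
  rw [h, hxv, hyw, ← smul_sub, real_inner_smul_left]
  exact mul_nonneg hl.le (hA _ _ _ _ hv hw)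

/-- The displacement `‖z - J l z‖` of the resolvent is monotone in the parameter `l`. -/
theorem norm_sub_resolvent_mono {A : H → Set H}
    (hA : ∀ u v a b : H, u ∈ A a → v ∈ A b → 0 ≤ ⟪u - v, a - b⟫) {J : ℝ → H → H}
    (hJ : ∀ l : ℝ, 0 < l → ∀ z : H, ∃ v ∈ A (J l z), z - J l z = l • v)
    {l m : ℝ} (hl : 0 < l) (hlm : l ≤ m) (z : H) : ‖z - J l z‖ ≤ ‖z - J m z‖ := by
  rcases hlm.eq_or_lt with rfl | hlt
  · rfl
  have hm : 0 < m := hl.trans hlt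
  obtain ⟨v, hv, hzv⟩ := hJ l hl z
  obtain ⟨w, hw, hzw⟩ := hJ m hm z
  have key := hA _ _ _ _ hv hw
  have h : J l z - J m z = m • w - l • v := by rw [← hzv, ← hzw]; abel
  rw [h] at key
  rw [hzv, hzw]
  apply norm_le_norm_of_inner_sub_nonneg
  have hsq : 0 ≤ ⟪m • w - l • v, m • w - l • v⟫ := real_inner_self_nonneg
  have hid : (m - l) * ⟪l • v, m • w - l • v⟫
      = l * m * ⟪v - w, m • w - l • v⟫ + l * ⟪m • w - l • v, m • w - l • v⟫ := by
    simp only [inner_sub_left, inner_sub_right, real_inner_smul_left, real_inner_smul_right,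
      real_inner_comm v w]
    ring
  refine nonneg_of_mul_nonneg_right ?_ (sub_pos.2 hlt)
  rw [hid]
  positivity

end Resolvent

theorem stmt_2 {H : Type*} [NormedAddCommGroup H] [InnerProductSpace ℝ H] [CompleteSpace H]
    (A : H → Set H)
    (hA : ∀ u v a b : H, u ∈ A a → v ∈ A b → 0 ≤ ⟪u - v, a - b⟫)
    (J : ℝ → H → H)
    (hJ : ∀ l : ℝ, 0 < l → ∀ z : H, ∃ v ∈ A (J l z), z - J l z = l • v)
    (θ : ℝ) (hθ : 0 < θ)
    (Γ : H → ℝ)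
    (hΓ : ∀ z : H, Γ z = sInf {α : ℝ | 0 < α ∧ ‖z - J α⁻¹ z‖ ≤ α * θ}) :
    ∀ x y : H, |Γ x - Γ y| ≤ ‖x - y‖ / θ := by
  have hne (z : H) : {α : ℝ | 0 < α ∧ ‖z - J α⁻¹ z‖ ≤ α * θ}.Nonempty := by
    have h1 : 1 ≤ max 1 (‖z - J 1 z‖ / θ) := le_max_left _ _
    refine ⟨max 1 (‖z - J 1 z‖ / θ), by linarith, ?_⟩
    refine (norm_sub_resolvent_mono hA hJ (inv_pos.2 (by linarith)) (inv_le_one_of_one_le₀ h1)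
      z).trans ?_
    rw [← div_le_iff₀ hθ]
    exact le_max_right _ _
  have hle (x y : H) : Γ y ≤ Γ x + ‖x - y‖ / θ := by
    rw [← sub_le_iff_le_add, hΓ x]
    refine le_csInf (hne x) fun α ⟨hα, hαx⟩ => ?_
    rw [sub_le_iff_le_add, hΓ y]
    have hd : 0 ≤ ‖x - y‖ / θ := by positivity
    have hβ : 0 < α + ‖x - y‖ / θ := by linarith
    refine csInf_le ⟨0, fun β hβ => hβ.1.le⟩ ⟨hβ, ?_⟩
    have hmono := norm_sub_resolvent_mono hA hJ (inv_pos.2 hβ)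
      (inv_anti₀ hα (le_add_of_nonneg_right hd)) x
    have hlip := norm_sub_resolvent_sub_le hA hJ (inv_pos.2 hβ) y x
    rw [norm_sub_rev y x] at hlip
    rw [add_mul, div_mul_cancel₀ _ hθ.ne']
    linarith [norm_le_norm_add_norm_sub' (y - J (α + ‖x - y‖ / θ)⁻¹ y)
      (x - J (α + ‖x - y‖ / θ)⁻¹ x)]
  intro x y
  have hyx := hle y x
  rw [norm_sub_rev y x] at hyx
  rw [abs_le]
  constructor <;> linarith [hle x y]
end

section
/- Let H be a real Hilbert space, A : H → Set H a monotone operator, J : ℝ → H → H a resolvent family for A, and θ > 0. Let x₀ ∈ H and λ₀ > 0 satisfy λ₀·‖x₀ − J(λ₀)(x₀)‖ = θ, and let 0 < r < θ/λ₀. Then for all x, y ∈ H with ‖x − x₀‖ ≤ r and ‖y − x₀‖ ≤ r, and all λ, μ > 0 with λ·‖x − J(λ)(x)‖ = θ and μ·‖y − J(μ)(y)‖ = θ, one has ‖(J(λ)(x) − x) − (J(μ)(y) − y)‖ ≤ (2θ/(θ − λ₀·r))·‖x − y‖. In particular, the vector field F(x) = J(Λ_θ(x))(x) − x is locally Lipschitz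 continuous on H \ A⁻¹(0). -/
open RealInnerProductSpace

/-- If `‖p‖ • p - ‖q‖ • q` makes an acute angle with `d - (p - q)`, then `‖p - q‖ ≤ 2 * ‖d‖`. -/
theorem norm_sub_le_two_mul_of_inner_norm_smul_sub_nonneg {H : Type*} [NormedAddCommGroup H]
    [InnerProductSpace ℝ H] {p q d : H} (hp : p ≠ 0)
    (h : 0 ≤ ⟪‖p‖ • p - ‖q‖ • q, d - (p - q)⟫) : ‖p - q‖ ≤ 2 * ‖d‖ := by
  have hp' : 0 < ‖p‖ := norm_pos_iff.mpr hp
  have hpos : 0 < (‖p‖ + ‖q‖) / 2 := by positivity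
  have hinner : ⟪‖p‖ • p - ‖q‖ • q, p - q⟫ =
      (‖p‖ + ‖q‖) / 2 * (‖p - q‖ ^ 2 + |‖p‖ - ‖q‖| ^ 2) := by
    rw [sq_abs, norm_sub_sq_real]
    simp only [inner_sub_left, inner_sub_right, real_inner_smul_left,
      real_inner_self_eq_norm_sq, real_inner_comm p q]
    ring
  have hnorm : ‖‖p‖ • p - ‖q‖ • q‖ ≤
      (‖p‖ + ‖q‖) / 2 * (‖p - q‖ + |‖p‖ - ‖q‖|) := by
    have hsplit : ‖p‖ • p - ‖q‖ • q =
        ((‖p‖ + ‖q‖) / 2) • (p - q) + ((‖p‖ - ‖q‖) / 2) • (p + q) := by module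
    calc ‖‖p‖ • p - ‖q‖ • q‖
        ≤ (‖p‖ + ‖q‖) / 2 * ‖p - q‖ + |‖p‖ - ‖q‖| / 2 * ‖p + q‖ := by
          rw [hsplit]
          refine (norm_add_le _ _).trans_eq ?_
          rw [norm_smul, norm_smul, Real.norm_of_nonneg hpos.le, Real.norm_eq_abs, abs_div,
            abs_two]
      _ ≤ (‖p‖ + ‖q‖) / 2 * ‖p - q‖ + |‖p‖ - ‖q‖| / 2 * (‖p‖ + ‖q‖) := by
          gcongr
          exact norm_add_le p q
      _ = _ := by ring
  have hcs : ‖p - q‖ ^ 2 + |‖p‖ - ‖q‖| ^ 2 ≤ (‖p - q‖ + |‖p‖ - ‖q‖|) * ‖d‖ := by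
    refine le_of_mul_le_mul_left ?_ hpos
    rw [inner_sub_right, hinner] at h
    have := real_inner_le_norm (‖p‖ • p - ‖q‖ • q) d
    have := mul_le_mul_of_nonneg_right hnorm (norm_nonneg d)
    linarith
  have ht := abs_nonneg (‖p‖ - ‖q‖)
  have hd := norm_nonneg d
  by_contra! hlt
  nlinarith [sq_nonneg (‖p - q‖ - |‖p‖ - ‖q‖|)]

theorem stmt_3 {H : Type*} [NormedAddCommGroup H] [InnerProductSpace ℝ H] [CompleteSpace H]
    (A : H → Set H)
    (hA : ∀ u v a b : H, u ∈ A a → v ∈ A b → 0 ≤ ⟪u - v, a - b⟫)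
    (J : ℝ → H → H)
    (hJ : ∀ l : ℝ, 0 < l → ∀ z : H, ∃ v ∈ A (J l z), z - J l z = l • v)
    (θ : ℝ) (hθ : 0 < θ)
    (x₀ : H) (l₀ : ℝ) (hl₀ : 0 < l₀) (hx₀ : l₀ * ‖x₀ - J l₀ x₀‖ = θ)
    (r : ℝ) (hr : 0 < r) (hrθ : r < θ / l₀) :
    ∀ x y : H, ‖x - x₀‖ ≤ r → ‖y - x₀‖ ≤ r →
      ∀ l μ : ℝ, 0 < l → 0 < μ →
        l * ‖x - J l x‖ = θ → μ * ‖y - J μ y‖ = θ →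
        ‖(J l x - x) - (J μ y - y)‖ ≤ (2 * θ / (θ - l₀ * r)) * ‖x - y‖ := by
  intro x y _ _ l μ hl hμ hx hy
  obtain ⟨u, hu, hxu⟩ := hJ l hl x
  obtain ⟨v, hv, hyv⟩ := hJ μ hμ y
  have hp : x - J l x ≠ 0 := by
    intro h0
    rw [h0, norm_zero, mul_zero] at hx
    exact hθ.ne hx
  have hpu : ‖x - J l x‖ • (x - J l x) = θ • u := by
    rw [← hx, mul_comm, mul_smul, ← hxu]
  have hqv : ‖y - J μ y‖ • (y - J μ y) = θ • v := by
    rw [← hy, mul_comm, mul_smul, ← hyv]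
  have hmono : 0 ≤ ⟪‖x - J l x‖ • (x - J l x) - ‖y - J μ y‖ • (y - J μ y),
      (x - y) - ((x - J l x) - (y - J μ y))⟫ := by
    rw [hpu, hqv, ← smul_sub, real_inner_smul_left,
      show (x - y) - ((x - J l x) - (y - J μ y)) = J l x - J μ y by abel]
    exact mul_nonneg hθ.le (hA u v _ _ hu hv)
  have hden : 0 < θ - l₀ * r := by
    have := (lt_div_iff₀ hl₀).mp hrθ
    linarith
  have hconst : 2 ≤ 2 * θ / (θ - l₀ * r) := by
    rw [le_div_iff₀ hden]
    nlinarith [mul_pos hl₀ hr]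
  calc ‖(J l x - x) - (J μ y - y)‖ = ‖(x - J l x) - (y - J μ y)‖ := by
        rw [← norm_neg]
        congr 1
        abel
    _ ≤ 2 * ‖x - y‖ := norm_sub_le_two_mul_of_inner_norm_smul_sub_nonneg hp hmono
    _ ≤ (2 * θ / (θ - l₀ * r)) * ‖x - y‖ := by gcongr
end

section
/- Let H be a real Hilbert space, A : H → Set H a monotone operator, θ > 0, and let (x, λ, y, v) be a solution of the system (LSP) on [0, ∞). Then for all s, t ≥ 0, |λ(t) − λ(s)| ≤ λ(t)·λ(s)·‖x(t) − x(s)‖/θ. In particular, λ is locally Lipschitz continuous, and at every point t where λ is differentiable, |λ'(t)| ≤ λ(t). -/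
open RealInnerProductSpace

/-- If `‖w‖ • w` and `‖w'‖ • w'` are monotonically related to `x - w` and `x' - w'`, then the norms
of `w` and `w'` differ by at most the distance between `x` and `x'`. -/
theorem abs_norm_sub_norm_le_of_inner_nonneg {H : Type*} [NormedAddCommGroup H]
    [InnerProductSpace ℝ H] (w w' x x' : H)
    (h : 0 ≤ ⟪‖w‖ • w - ‖w'‖ • w', (x - w) - (x' - w')⟫) :
    |‖w‖ - ‖w'‖| ≤ ‖x - x'‖ := by
  set a := ‖w‖
  set b := ‖w'‖
  have ha0 : 0 ≤ a := norm_nonneg w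
  have hb0 : 0 ≤ b := norm_nonneg w'
  have hc : ⟪w, w'⟫ ≤ a * b := real_inner_le_norm w w'
  have hab : 0 ≤ a * b := mul_nonneg ha0 hb0
  have hww : ⟪w, w⟫ = a ^ 2 := real_inner_self_eq_norm_sq w
  have hww' : ⟪w', w'⟫ = b ^ 2 := real_inner_self_eq_norm_sq w'
  have hcomm : ⟪w', w⟫ = ⟪w, w'⟫ := real_inner_comm w w'
  obtain ⟨e, he⟩ : ∃ e, e = a * b - ⟪w, w'⟫ := ⟨_, rfl⟩
  have he0 : 0 ≤ e := by linarith
  have hce : ⟪w, w'⟫ = a * b - e := by linarith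
  have hN : (a + b) * ((a - b) ^ 2 + e) ≤ ⟪a • w - b • w', x - x'⟫ := by
    have hsplit : (x - w) - (x' - w') = (x - x') - (w - w') := by abel
    have hexp : ⟪a • w - b • w', w - w'⟫ = (a + b) * ((a - b) ^ 2 + e) := by
      simp only [inner_sub_left, inner_sub_right, real_inner_smul_left, hww, hww', hcomm, hce]
      ring
    rw [hsplit, inner_sub_right, hexp] at h
    linarith
  have hD : ‖a • w - b • w'‖ ^ 2 = (a ^ 2 - b ^ 2) ^ 2 + 2 * (a * b) * e := by
    rw [← real_inner_self_eq_norm_sq]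
    simp only [inner_sub_left, inner_sub_right, real_inner_smul_left, real_inner_smul_right,
      hww, hww', hcomm, hce]
    ring
  have hCS : (a + b) * ((a - b) ^ 2 + e) ≤ ‖a • w - b • w'‖ * ‖x - x'‖ :=
    hN.trans (real_inner_le_norm _ _)
  have hsq : (|a - b| * ‖a • w - b • w'‖) ^ 2 ≤ ((a + b) * ((a - b) ^ 2 + e)) ^ 2 := by
    rw [mul_pow, hD, sq_abs]
    have h1 : 0 ≤ (a + b) ^ 2 * e ^ 2 := by positivity
    have h2 : 0 ≤ (a - b) ^ 2 * e * (2 * (a ^ 2 + b ^ 2 + a * b)) := by positivity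
    linear_combination h1 + h2
  have hle : |a - b| * ‖a • w - b • w'‖ ≤ (a + b) * ((a - b) ^ 2 + e) :=
    (sq_le_sq₀ (by positivity) (by positivity)).1 hsq
  rcases (norm_nonneg (a • w - b • w')).eq_or_lt with h0 | h0
  · have h1 : (a ^ 2 - b ^ 2) ^ 2 = 0 := by
      rw [← h0] at hD
      nlinarith [sq_nonneg (a ^ 2 - b ^ 2), mul_nonneg hab he0]
    have h2 : a ^ 2 = b ^ 2 := sub_eq_zero.1 (pow_eq_zero_iff two_ne_zero |>.1 h1)
    have h3 : a = b := (sq_eq_sq₀ ha0 hb0).1 h2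
    simp [h3]
  · exact le_of_mul_le_mul_left ((mul_comm _ _).trans_le (hle.trans hCS)) h0

theorem stmt_4 {H : Type*} [NormedAddCommGroup H] [InnerProductSpace ℝ H] [CompleteSpace H]
    (A : H → Set H)
    (hA : ∀ u v a b : H, u ∈ A a → v ∈ A b → 0 ≤ ⟪u - v, a - b⟫)
    (θ : ℝ) (hθ : 0 < θ)
    (x : ℝ → H) (l : ℝ → ℝ) (y v : ℝ → H)
    (hderiv : ∀ t, 0 ≤ t → HasDerivWithinAt x (y t - x t) (Set.Ici 0) t)
    (hlpos : ∀ t, 0 ≤ t → 0 < l t)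
    (hmem : ∀ t, 0 ≤ t → v t ∈ A (y t))
    (heq : ∀ t, 0 ≤ t → l t • v t + y t - x t = 0)
    (hls : ∀ t, 0 ≤ t → l t * ‖y t - x t‖ = θ) :
    (∀ s t, 0 ≤ s → 0 ≤ t → |l t - l s| ≤ l t * l s * ‖x t - x s‖ / θ) ∧
    LocallyLipschitzOn (Set.Ici 0) l ∧
    (∀ t, 0 ≤ t → ∀ d : ℝ, HasDerivAt l d t → |d| ≤ l t) := by
  have hgl : ∀ t, 0 ≤ t → ‖y t - x t‖ = θ / l t := fun t ht ↦ by
    rw [eq_div_iff (hlpos t ht).ne', mul_comm, hls t ht]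
  have hscale : ∀ t, 0 ≤ t → ‖x t - y t‖ • (x t - y t) = θ • v t := fun t ht ↦ by
    have h1 : x t - y t = l t • v t := by
      rw [← sub_eq_zero, ← neg_eq_zero, ← heq t ht]; abel
    rw [norm_sub_rev, hgl t ht, h1, smul_smul, div_mul_cancel₀ _ (hlpos t ht).ne']
  have hg : ∀ s t, 0 ≤ s → 0 ≤ t → |θ / l t - θ / l s| ≤ ‖x t - x s‖ := fun s t hs ht ↦ by
    have h := abs_norm_sub_norm_le_of_inner_nonneg (x t - y t) (x s - y s) (x t) (x s) (by
      rw [hscale t ht, hscale s hs, ← smul_sub, real_inner_smul_left, sub_sub_cancel,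
        sub_sub_cancel]
      exact mul_nonneg hθ.le (hA _ _ _ _ (hmem t ht) (hmem s hs)))
    rwa [norm_sub_rev (x t), hgl t ht, norm_sub_rev (x s), hgl s hs] at h
  have hmain : ∀ s t, 0 ≤ s → 0 ≤ t → |l t - l s| ≤ l t * l s * ‖x t - x s‖ / θ :=
    fun s t hs ht ↦ by
      have hlt := hlpos t ht
      have hls' := hlpos s hs
      have h1 : l t - l s = -(l t * l s / θ * (θ / l t - θ / l s)) := by
        field_simp
        ring
      rw [h1, abs_neg, abs_mul, abs_of_pos (by positivity), mul_div_right_comm (l t * l s) ‖x t - x s‖]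
      exact mul_le_mul_of_nonneg_left (hg s t hs ht) (by positivity)
  refine ⟨hmain, ?_, ?_⟩
  · intro t ht
    have hxc : ContinuousWithinAt x (Set.Ici 0) t := (hderiv t ht).continuousWithinAt
    have hgt : 0 < θ / l t := div_pos hθ (hlpos t ht)
    obtain ⟨δ, hδ, hball⟩ := Metric.continuousWithinAt_iff.1 hxc (θ / l t / 2) (by positivity)
    have hbd : ∀ s ∈ Metric.ball t δ ∩ Set.Ici 0,
        θ / l t / 2 ≤ θ / l s ∧ θ / l s ≤ 2 * (θ / l t) := fun s hs ↦ by
      have h1 := hball hs.2 hs.1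
      rw [dist_eq_norm] at h1
      have h2 := abs_le.1 (hg t s ht hs.2)
      constructor <;> linarith [h2.1, h2.2]
    have hl : ∀ s ∈ Metric.ball t δ ∩ Set.Ici 0, l s ≤ 2 * l t := fun s hs ↦ by
      have h1 := (hbd s hs).1
      have h2 := hlpos s hs.2
      have h3 := hlpos t ht
      rw [div_div, div_le_div_iff_of_pos_left hθ (by positivity) h2] at h1
      linarith
    have hconv : Convex ℝ (Metric.ball t δ ∩ Set.Ici 0) := (convex_ball t δ).inter (convex_Ici 0)
    have hxL : ∀ r ∈ Metric.ball t δ ∩ Set.Ici 0, ∀ s ∈ Metric.ball t δ ∩ Set.Ici 0,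
        ‖x r - x s‖ ≤ 2 * (θ / l t) * ‖r - s‖ := fun r hr s hs ↦
      hconv.norm_image_sub_le_of_norm_hasDerivWithin_le
        (fun u hu ↦ (hderiv u hu.2).mono Set.inter_subset_right)
        (fun u hu ↦ (hgl u hu.2).trans_le (hbd u hu).2) hs hr
    refine ⟨(2 * l t * (2 * l t) * (2 * (θ / l t)) / θ).toNNReal, Metric.ball t δ ∩ Set.Ici 0,
      Filter.inter_mem (mem_nhdsWithin_of_mem_nhds (Metric.ball_mem_nhds t hδ))
        self_mem_nhdsWithin, LipschitzOnWith.of_dist_le_mul fun r hr s hs ↦ ?_⟩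
    have h3 := hlpos t ht
    have h4 := hlpos r hr.2
    have h5 := hlpos s hs.2
    rw [Real.coe_toNNReal _ (by positivity), Real.dist_eq, Real.dist_eq, ← Real.norm_eq_abs (r - s)]
    calc |l r - l s| ≤ l r * l s * ‖x r - x s‖ / θ := hmain s r hs.2 hr.2
      _ ≤ 2 * l t * (2 * l t) * (2 * (θ / l t) * ‖r - s‖) / θ := by
        gcongr
        · exact hl r hr
        · exact hl s hs
        · exact hxL r hr s hs
      _ = 2 * l t * (2 * l t) * (2 * (θ / l t)) / θ * ‖r - s‖ := by ring
  · intro t ht d hd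
    have hls' := (hasDerivWithinAt_iff_tendsto_slope' Set.self_notMem_Ioi).1
      (hd.hasDerivWithinAt (s := Set.Ioi t))
    have hxs := (hasDerivWithinAt_iff_tendsto_slope' Set.self_notMem_Ioi).1
      ((hderiv t ht).mono fun s (hs : t < s) ↦ ht.trans hs.le)
    have hlc : Filter.Tendsto l (nhdsWithin t (Set.Ioi t)) (nhds (l t)) :=
      hd.continuousAt.continuousWithinAt
    have hlim : l t = l t * l t * ‖y t - x t‖ / θ := by
      rw [mul_assoc, hls t ht, mul_div_cancel_right₀ _ hθ.ne']
    rw [hlim]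
    refine le_of_tendsto_of_tendsto hls'.abs (((hlc.const_mul (l t)).mul hxs.norm).div_const θ) ?_
    filter_upwards [self_mem_nhdsWithin] with s (hs : t < s)
    have h1 := hmain t s ht (ht.trans hs.le)
    have h2 : 0 < s - t := sub_pos.2 hs
    rw [slope_def_module, slope_def_module, smul_eq_mul, abs_mul, norm_smul, Real.norm_eq_abs,
      abs_of_pos (inv_pos.2 h2)]
    calc (s - t)⁻¹ * |l s - l t| ≤ (s - t)⁻¹ * (l s * l t * ‖x s - x t‖ / θ) := by gcongr
      _ = l t * l s * ((s - t)⁻¹ * ‖x s - x t‖) / θ := by ring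
end

section
/- Let H be a real Hilbert space, A : H → Set H a monotone operator, θ > 0, and let (x, λ, y, v) be a solution of the system (LSP) on [0, ∞) in which the map λ is continuous. Then λ is nondecreasing on [0, ∞): for all 0 ≤ s ≤ t, λ(s) ≤ λ(t). Consequently t ↦ ‖y(t) − x(t)‖ = θ/λ(t) is nonincreasing, and for all 0 ≤ t₀ ≤ t₁, λ(t₀) ≤ λ(t₁) ≤ e^{t₁ − t₀}·λ(t₀). -/
open RealInnerProductSpace

open Filter Topology in
/-- A continuous function on `[0, ∞)` whose upper right Dini derivative is nonpositive
is antitone. -/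
lemma antitoneOn_of_right_increment_le {f : ℝ → ℝ} (hf : ContinuousOn f (Set.Ici 0))
    (hd : ∀ t, 0 ≤ t → ∃ φ : ℝ → ℝ, Tendsto φ (𝓝[>] t) (𝓝 0) ∧
      ∀ᶠ s in 𝓝[>] t, f s - f t ≤ (s - t) * φ s) :
    AntitoneOn f (Set.Ici 0) := by
  intro a ha b _ hab
  have ha' : (0 : ℝ) ≤ a := ha
  refine image_le_of_liminf_slope_right_le_deriv_boundary (f := f) (a := a) (b := b)
    (B := fun _ => f a) (B' := fun _ => 0)
    (hf.mono fun z hz => ha'.trans hz.1) le_rfl continuousOn_const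
    (fun z _ => hasDerivWithinAt_const _ _ _) ?_ ⟨hab, le_rfl⟩
  intro z hz r hr
  obtain ⟨φ, hφ, hle⟩ := hd z (ha'.trans hz.1)
  apply Eventually.frequently
  filter_upwards [hle, hφ.eventually (gt_mem_nhds hr), self_mem_nhdsWithin] with s h1 h2 hs
  have hs' : 0 < s - z := sub_pos.2 hs
  rw [slope_def_field, div_lt_iff₀ hs']
  nlinarith

section Monotone

variable {H : Type*} [NormedAddCommGroup H] [InnerProductSpace ℝ H]

lemma norm_sub_le_or_of_inner_nonneg {p q e : H} {μ m : ℝ} (hμ : 0 ≤ μ) (hm : 0 ≤ m)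
    (h : 0 ≤ ⟪q - p, e - (m • q - μ • p)⟫) :
    (‖q‖ - ‖p‖) * (m + μ) ≤ ‖e‖ ∨ m * ‖q‖ - μ * ‖p‖ ≤ ‖e‖ := by
  by_contra! hc
  obtain ⟨h1, h2⟩ := hc
  have he := norm_nonneg e
  have hd : 0 < ‖q‖ - ‖p‖ := by
    by_contra! hd
    nlinarith
  have hw : ‖q‖ - ‖p‖ ≤ ‖q - p‖ := norm_sub_norm_le q p
  have hcs : ⟪q - p, e⟫ ≤ ‖q - p‖ * ‖e‖ := real_inner_le_norm _ _
  have hw2 : ‖q - p‖ ^ 2 = ‖q‖ ^ 2 - 2 * ⟪q, p⟫ + ‖p‖ ^ 2 := norm_sub_sq_real q p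
  have hexp : ⟪q - p, m • q - μ • p⟫ = m * ‖q‖ ^ 2 + μ * ‖p‖ ^ 2 - (m + μ) * ⟪q, p⟫ := by
    simp only [inner_sub_left, inner_sub_right, real_inner_smul_right, real_inner_self_eq_norm_sq,
      real_inner_comm q p]
    ring
  rw [inner_sub_right, hexp] at h
  have hmul : 0 ≤ (‖q - p‖ - (‖q‖ - ‖p‖)) *
      ((m + μ) * (‖q - p‖ + (‖q‖ - ‖p‖)) / 2 - ‖e‖) := by
    apply mul_nonneg (by linarith)
    nlinarith [mul_nonneg (add_nonneg hm hμ) (sub_nonneg.2 hw)]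
  nlinarith [mul_pos hd (sub_pos.2 h2)]

/-- One-step comparison of the residuals `l • p` and `m • q` of two proximal points: `h` is the
step length and `e` the consistency error of an explicit Euler step. -/
lemma residual_comparison {p q e : H} {l m h : ℝ} (hl : 0 < l) (hm : 0 < m)
    (h0 : 0 ≤ h) (h1 : h ≤ 1) (hlm : l * (l * ‖p‖) = m * (m * ‖q‖))
    (hmono : 0 ≤ ⟪q - p, e - (m • q - ((1 - h) * l) • p)⟫) :
    m * ‖q‖ - l * ‖p‖ ≤ ‖e‖ ∧ l * ‖p‖ - m * ‖q‖ ≤ h * (l * ‖p‖) + ‖e‖ := by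
  have hp := norm_nonneg p
  have hq := norm_nonneg q
  have he := norm_nonneg e
  have hμ : 0 ≤ (1 - h) * l := mul_nonneg (by linarith) hl.le
  have hr : 0 ≤ h * (l * ‖p‖) := by positivity
  have hmono' : 0 ≤ ⟪p - q, -e - (((1 - h) * l) • p - m • q)⟫ := by
    rw [← inner_neg_neg]
    convert hmono using 2 <;> abel
  constructor
  · rcases norm_sub_le_or_of_inner_nonneg hμ hm.le hmono with hA | hB
    · by_contra! hc
      have hml : m < l := by
        by_contra! hml
        nlinarith [mul_nonneg hl.le hp, mul_nonneg hm.le hq]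
      have h3 : m * ‖p‖ ≤ l * ‖p‖ := by gcongr
      have h4 : ‖p‖ < ‖q‖ := by
        by_contra! h4
        nlinarith [mul_le_mul_of_nonneg_left h4 hm.le]
      nlinarith [mul_nonneg (sub_pos.2 h4).le hμ]
    · nlinarith
  · rcases norm_sub_le_or_of_inner_nonneg hm.le hμ hmono' with hA | hB
    · rw [norm_neg] at hA
      by_contra! hc
      have hml : l < m := by
        by_contra! hml
        nlinarith [mul_nonneg hl.le hp, mul_nonneg hm.le hq]
      have h3 : l * ‖p‖ ≤ m * ‖p‖ := by gcongr
      have h4 : ‖q‖ < ‖p‖ := by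
        by_contra! h4
        nlinarith [mul_le_mul_of_nonneg_left h4 hm.le]
      nlinarith [mul_nonneg (sub_pos.2 h4).le hμ]
    · rw [norm_neg] at hB
      nlinarith

end Monotone

open Filter Topology in
theorem stmt_5 {H : Type*} [NormedAddCommGroup H] [InnerProductSpace ℝ H] [CompleteSpace H]
    (A : H → Set H)
    (hA : ∀ u v a b : H, u ∈ A a → v ∈ A b → 0 ≤ ⟪u - v, a - b⟫)
    (θ : ℝ) (hθ : 0 < θ)
    (x : ℝ → H) (l : ℝ → ℝ) (y v : ℝ → H)
    (hderiv : ∀ t, 0 ≤ t → HasDerivWithinAt x (y t - x t) (Set.Ici 0) t)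
    (hlpos : ∀ t, 0 ≤ t → 0 < l t)
    (hmem : ∀ t, 0 ≤ t → v t ∈ A (y t))
    (heq : ∀ t, 0 ≤ t → l t • v t + y t - x t = 0)
    (hls : ∀ t, 0 ≤ t → l t * ‖y t - x t‖ = θ)
    (hlcont : ContinuousOn l (Set.Ici 0)) :
    MonotoneOn l (Set.Ici 0) ∧
    AntitoneOn (fun t => ‖y t - x t‖) (Set.Ici 0) ∧
    (∀ t₀ t₁, 0 ≤ t₀ → t₀ ≤ t₁ → l t₀ ≤ l t₁ ∧ l t₁ ≤ Real.exp (t₁ - t₀) * l t₀) := by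
  set r : ℝ → ℝ := fun t => ‖y t - x t‖ with hr
  have hrpos : ∀ t, 0 ≤ t → 0 < r t := fun t ht =>
    pos_of_mul_pos_right ((hls t ht).symm ▸ hθ) (hlpos t ht).le
  have hy : ∀ t, 0 ≤ t → y t = x t - l t • v t := fun t ht => by
    linear_combination (norm := module) heq t ht
  have hrv : ∀ t, 0 ≤ t → r t = l t * ‖v t‖ := fun t ht => by
    simp only [hr, hy t ht, sub_sub_cancel_left, norm_neg, norm_smul, Real.norm_eq_abs,
      abs_of_pos (hlpos t ht)]
  have hrcont : ContinuousOn r (Set.Ici 0) := by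
    refine (continuousOn_const.div hlcont fun t ht => (hlpos t ht).ne').congr
      (f := fun t => θ / l t) fun t ht => ?_
    rw [eq_div_iff (hlpos t ht).ne', mul_comm]
    exact hls t ht
  have herr : ∀ t, 0 ≤ t →
      Tendsto (fun s => ‖x s - x t - (s - t) • (y t - x t)‖ / (s - t)) (𝓝[>] t) (𝓝 0) := by
    intro t ht
    have h := (hderiv t ht).mono (Set.Ioi_subset_Ici_self.trans (Set.Ici_subset_Ici.2 ht))
    exact (hasDerivWithinAt_iff_isLittleO.1 h).norm_left.tendsto_div_nhds_zero
  have hstep : ∀ t, 0 ≤ t → ∀ s, t < s → s < t + 1 →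
      r s - r t ≤ ‖x s - x t - (s - t) • (y t - x t)‖ ∧
      r t - r s ≤ (s - t) * r t + ‖x s - x t - (s - t) • (y t - x t)‖ := by
    intro t ht s hts hs1
    have hs : 0 ≤ s := ht.trans hts.le
    rw [hrv t ht, hrv s hs]
    refine residual_comparison (hlpos t ht) (hlpos s hs) (sub_nonneg.2 hts.le) (by linarith) ?_ ?_
    · rw [← hrv t ht, ← hrv s hs]
      exact (hls t ht).trans (hls s hs).symm
    · convert hA _ _ _ _ (hmem s hs) (hmem t ht) using 2
      rw [hy t ht, hy s hs]
      module
  have hnear : ∀ t : ℝ, ∀ᶠ s in 𝓝[>] t, t < s ∧ s < t + 1 := fun t =>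
    Ioo_mem_nhdsGT (by linarith)
  have hanti : AntitoneOn r (Set.Ici 0) := by
    refine antitoneOn_of_right_increment_le hrcont fun t ht => ⟨_, herr t ht, ?_⟩
    filter_upwards [hnear t] with s hs
    rw [mul_div_cancel₀ _ (sub_pos.2 hs.1).ne']
    exact (hstep t ht s hs.1 hs.2).1
  have hexp : AntitoneOn (fun t => -(Real.exp t * r t)) (Set.Ici 0) := by
    refine antitoneOn_of_right_increment_le
      (Real.continuous_exp.continuousOn.mul hrcont).neg fun t ht => ?_
    have hrt : Tendsto r (𝓝[>] t) (𝓝 (r t)) :=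
      (hrcont t ht).mono (Set.Ioi_subset_Ici_self.trans (Set.Ici_subset_Ici.2 ht))
    refine ⟨fun s => Real.exp t *
      (r t - r s + ‖x s - x t - (s - t) • (y t - x t)‖ / (s - t)), ?_, ?_⟩
    · simpa using ((hrt.const_sub (r t)).add (herr t ht)).const_mul (Real.exp t)
    filter_upwards [hnear t] with s hs
    have hst : 0 < s - t := sub_pos.2 hs.1
    have h2 := (hstep t ht s hs.1 hs.2).2
    have hes : Real.exp s = Real.exp t * Real.exp (s - t) := by
      rw [← Real.exp_add, add_sub_cancel]
    have h3 := mul_le_mul_of_nonneg_right (Real.add_one_le_exp (s - t))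
      (hrpos s (ht.trans hs.1.le)).le
    calc -(Real.exp s * r s) - -(Real.exp t * r t)
        = Real.exp t * (r t - Real.exp (s - t) * r s) := by rw [hes]; ring
      _ ≤ Real.exp t * ((s - t) * (r t - r s) + ‖x s - x t - (s - t) • (y t - x t)‖) := by
          gcongr
          linarith
      _ = _ := by field_simp
  have hmon : MonotoneOn l (Set.Ici 0) := by
    intro a ha b hb hab
    refine le_of_mul_le_mul_right ?_ (hrpos a ha)
    calc l a * r a = l b * r b := (hls a ha).trans (hls b hb).symm
      _ ≤ l b * r a := mul_le_mul_of_nonneg_left (hanti ha hb hab) (hlpos b hb).le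
  refine ⟨hmon, hanti, fun a b ha hab => ?_⟩
  have hb : 0 ≤ b := ha.trans hab
  refine ⟨hmon ha hb hab, le_of_mul_le_mul_right ?_ (hrpos a ha)⟩
  have h : r a ≤ Real.exp (b - a) * r b := by
    have h := neg_le_neg_iff.1 (hexp ha hb hab)
    rw [Real.exp_sub, div_mul_eq_mul_div, le_div_iff₀ (Real.exp_pos a)]
    linarith
  calc l b * r a ≤ l b * (Real.exp (b - a) * r b) :=
        mul_le_mul_of_nonneg_left h (hlpos b hb).le
    _ = Real.exp (b - a) * (l b * r b) := by ring
    _ = Real.exp (b - a) * l a * r a := by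
        rw [mul_assoc]
        exact congrArg _ ((hls b hb).trans (hls a ha).symm)
end

section
/- Let H be a real Hilbert space, A : H → Set H a monotone operator, θ > 0, and let (x, λ, y, v) be a solution of the system (LSP) on [0, ∞) with λ nondecreasing. Let z ∈ H satisfy 0 ∈ A(z). Then: (i) the function t ↦ ‖x(t) − z‖ is nonincreasing on [0, ∞); (ii) for every t > 0, ‖y(t) − x(t)‖·√(2t) ≤ ‖x(0) − z‖; (iii) for every t > 0, λ(t)·‖x(0) − z‖ ≥ θ·√(2t); and (iv) for every t > 0, ‖v(t)‖ ≤ ‖x(0) − z‖²/(2θt). -/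
open RealInnerProductSpace

/-- If `x' = y - x` with `⟪x - y, y - z⟫ ≥ 0` and `‖y - x‖ ≥ r` on `[0, T]`, then
`‖x - z‖²` decreases there at rate at least `2 r²`. -/
theorem antitoneOn_norm_sub_sq_add {H : Type*} [NormedAddCommGroup H] [InnerProductSpace ℝ H]
    {x y : ℝ → H} {z : H} {r T : ℝ} (hr : 0 ≤ r)
    (hderiv : ∀ t, 0 ≤ t → HasDerivWithinAt x (y t - x t) (Set.Ici 0) t)
    (hinner : ∀ t, 0 ≤ t → 0 ≤ ⟪x t - y t, y t - z⟫)
    (hle : ∀ t ∈ Set.Icc 0 T, r ≤ ‖y t - x t‖) :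
    AntitoneOn (fun t => ‖x t - z‖ ^ 2 + 2 * r ^ 2 * t) (Set.Icc 0 T) := by
  have hd (t : ℝ) (ht : 0 ≤ t) :
      HasDerivWithinAt (fun t => ‖x t - z‖ ^ 2 + 2 * r ^ 2 * t)
        (2 * ⟪x t - z, y t - x t⟫ + 2 * r ^ 2 * 1) (Set.Ici 0) t :=
    ((hderiv t ht).sub_const z).norm_sq.add ((hasDerivWithinAt_id t _).const_mul _)
  refine antitoneOn_of_hasDerivWithinAt_nonpos (convex_Icc 0 T)
    (fun t ht => ((hd t ht.1).continuousWithinAt).mono fun s hs => hs.1)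
    (fun t ht => (hd t (interior_subset ht).1).mono fun s hs => (interior_subset hs).1) ?_
  intro t ht
  have ht' := interior_subset ht
  have hsq : r ^ 2 ≤ ‖y t - x t‖ ^ 2 := pow_le_pow_left₀ hr (hle t ht') 2
  have hsplit : ⟪x t - z, y t - x t⟫ = -⟪x t - y t, y t - z⟫ - ‖y t - x t‖ ^ 2 := by
    rw [← real_inner_self_eq_norm_sq]
    simp only [inner_sub_left, inner_sub_right, real_inner_comm]
    ring
  linarith [hinner t ht'.1]

theorem stmt_6 {H : Type*} [NormedAddCommGroup H] [InnerProductSpace ℝ H] [CompleteSpace H]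
    (A : H → Set H)
    (hA : ∀ u v a b : H, u ∈ A a → v ∈ A b → 0 ≤ ⟪u - v, a - b⟫)
    (θ : ℝ) (hθ : 0 < θ)
    (x : ℝ → H) (l : ℝ → ℝ) (y v : ℝ → H)
    (hderiv : ∀ t, 0 ≤ t → HasDerivWithinAt x (y t - x t) (Set.Ici 0) t)
    (hlpos : ∀ t, 0 ≤ t → 0 < l t)
    (hmem : ∀ t, 0 ≤ t → v t ∈ A (y t))
    (heq : ∀ t, 0 ≤ t → l t • v t + y t - x t = 0)
    (hls : ∀ t, 0 ≤ t → l t * ‖y t - x t‖ = θ)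
    (hlmono : MonotoneOn l (Set.Ici 0))
    (z : H) (hz : 0 ∈ A z) :
    AntitoneOn (fun t => ‖x t - z‖) (Set.Ici 0) ∧
    (∀ t : ℝ, 0 < t → ‖y t - x t‖ * Real.sqrt (2 * t) ≤ ‖x 0 - z‖) ∧
    (∀ t : ℝ, 0 < t → θ * Real.sqrt (2 * t) ≤ l t * ‖x 0 - z‖) ∧
    (∀ t : ℝ, 0 < t → ‖v t‖ ≤ ‖x 0 - z‖ ^ 2 / (2 * θ * t)) := by
  have hinner (t : ℝ) (ht : 0 ≤ t) : 0 ≤ ⟪x t - y t, y t - z⟫ := by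
    have hxy : x t - y t = l t • v t := by
      rw [eq_comm, ← sub_eq_zero, ← heq t ht]
      abel
    have hmon := hA _ _ _ _ (hmem t ht) hz
    rw [sub_zero] at hmon
    rw [hxy, real_inner_smul_left]
    exact mul_nonneg (hlpos t ht).le hmon
  have hnorm (t : ℝ) (ht : 0 ≤ t) : ‖y t - x t‖ = θ / l t := by
    rw [eq_div_iff (hlpos t ht).ne', mul_comm, hls t ht]
  have hanti (T : ℝ) :
      AntitoneOn (fun t => ‖x t - z‖ ^ 2 + 2 * ‖y T - x T‖ ^ 2 * t) (Set.Icc 0 T) := by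
    refine antitoneOn_norm_sub_sq_add (norm_nonneg _) hderiv hinner fun t ht => ?_
    have hT : 0 ≤ T := ht.1.trans ht.2
    rw [hnorm t ht.1, hnorm T hT]
    exact div_le_div_of_nonneg_left hθ.le (hlpos t ht.1) (hlmono ht.1 hT ht.2)
  have hbound (t : ℝ) (ht : 0 < t) : ‖y t - x t‖ ^ 2 * (2 * t) ≤ ‖x 0 - z‖ ^ 2 := by
    have h := hanti t ⟨le_rfl, ht.le⟩ ⟨ht.le, le_rfl⟩ ht.le
    dsimp only at h
    linarith [sq_nonneg ‖x t - z‖]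
  have hsqrt (t : ℝ) (ht : 0 < t) : ‖y t - x t‖ * Real.sqrt (2 * t) ≤ ‖x 0 - z‖ := by
    refine le_of_pow_le_pow_left₀ two_ne_zero (norm_nonneg _) ?_
    rw [mul_pow, Real.sq_sqrt (by positivity)]
    exact hbound t ht
  refine ⟨fun a ha b hb hab => ?_, hsqrt, fun t ht => ?_, fun t ht => ?_⟩
  · have h := hanti b ⟨ha, hab⟩ ⟨hb, le_rfl⟩ hab
    dsimp only at h ⊢
    refine le_of_pow_le_pow_left₀ two_ne_zero (norm_nonneg _) ?_
    nlinarith [mul_nonneg (sq_nonneg ‖y b - x b‖) (sub_nonneg.2 hab)]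
  · rw [← hls t ht.le, mul_assoc]
    exact mul_le_mul_of_nonneg_left (hsqrt t ht) (hlpos t ht.le).le
  · have hv : l t * ‖v t‖ = ‖y t - x t‖ := by
      rw [← Real.norm_of_nonneg (hlpos t ht.le).le, ← norm_smul, norm_sub_rev]
      congr 1
      rw [← sub_eq_zero, ← heq t ht.le]
      abel
    have hθv : θ * ‖v t‖ = ‖y t - x t‖ ^ 2 := by
      rw [← hls t ht.le, mul_right_comm, hv, sq]
    rw [le_div_iff₀ (by positivity)]
    calc ‖v t‖ * (2 * θ * t) = θ * ‖v t‖ * (2 * t) := by ring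
      _ ≤ ‖x 0 - z‖ ^ 2 := hθv ▸ hbound t ht
end

section
/- Let H be a real Hilbert space, A : H → Set H a maximal monotone operator, θ > 0, and let (x, λ, y, v) be a solution of the system (LSP) on [0, ∞) with λ nondecreasing. Let S = A⁻¹(0) and assume the error bound condition: S ≠ ∅ and there exist ε > 0 and κ > 0 such that for all w, u ∈ H with u ∈ A(w) and ‖u‖ ≤ ε, the distance from w to S satisfies dist(w, S) ≤ κ·‖u‖. Then x(t) converges strongly (in norm) to some x* ∈ S, and for every α ∈ (0, 1) there exist positive constants c₀, c₁, c₂, c₃ such that for all t ≥ 0: dist(x(t), S) ≤ c₀·e^{−αt}, λ(t) ≥ c₁·e^{αt}, ‖v(t)‖ ≤ c₂·e^{−2αt}, and ‖x(t) − x*‖ ≤ c₃·e^{−αt}. -/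
open RealInnerProductSpace

/-- A discrete decay estimate at every scale yields exponential decay. -/
lemma mul_exp_le_of_forall_mul_one_add_le {f : ℝ → ℝ} {T b : ℝ} (hb : 0 ≤ b)
    (hf : ∀ t s, T ≤ t → t ≤ s → f s * (1 + b * (s - t)) ≤ f t) {t : ℝ} (ht : T ≤ t) :
    f t * Real.exp (b * (t - T)) ≤ f T := by
  have hlim := (Real.tendsto_one_add_div_pow_exp (b * (t - T))).const_mul (f t)
  refine le_of_tendsto hlim ?_
  filter_upwards [Filter.eventually_gt_atTop 0] with n hn
  have hn' : (0 : ℝ) < n := by exact_mod_cast hn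
  have hstep : 0 ≤ (t - T) / n := div_nonneg (by linarith) hn'.le
  have key : ∀ k : ℕ, f (T + k * ((t - T) / n)) * (1 + b * (t - T) / n) ^ k ≤ f T := by
    intro k
    induction k with
    | zero => simp
    | succ k ih =>
      refine le_trans ?_ ih
      have h := hf (T + k * ((t - T) / n)) (T + (k + 1 : ℕ) * ((t - T) / n))
        (by have := mul_nonneg (Nat.cast_nonneg (α := ℝ) k) hstep; linarith)
        (by push_cast; linarith)
      have hr : b * (T + (k + 1 : ℕ) * ((t - T) / n) - (T + k * ((t - T) / n)))
          = b * (t - T) / n := by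
        push_cast; ring
      rw [hr] at h
      have hpos : 0 ≤ (1 + b * (t - T) / n) ^ k := by
        have : 0 ≤ b * (t - T) / n := by rw [mul_div_assoc]; exact mul_nonneg hb hstep
        positivity
      calc _ = f (T + (k + 1 : ℕ) * ((t - T) / n)) * (1 + b * (t - T) / n)
            * (1 + b * (t - T) / n) ^ k := by ring
        _ ≤ _ := mul_le_mul_of_nonneg_right h hpos
  have h := key n
  rwa [mul_div_cancel₀ _ hn'.ne', add_sub_cancel] at h

/-- If the velocity `w` of a curve `x` satisfies `⟪x - z, w⟫ ≤ -c` on an interval, then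
`‖x - z‖ ^ 2` decreases at rate at least `2 * c` there. -/
lemma norm_sub_sq_add_le_of_inner_le {H : Type*} [NormedAddCommGroup H] [InnerProductSpace ℝ H]
    {x w : ℝ → H} {z : H} {t s c : ℝ} (hts : t ≤ s)
    (hx : ∀ r ∈ Set.Icc t s, HasDerivWithinAt x (w r) (Set.Icc t s) r)
    (hw : ∀ r ∈ Set.Icc t s, ⟪x r - z, w r⟫ ≤ -c) :
    ‖x s - z‖ ^ 2 + 2 * (s - t) * c ≤ ‖x t - z‖ ^ 2 := by
  have hd : ∀ r ∈ Set.Icc t s, HasDerivWithinAt (fun r => ‖x r - z‖ ^ 2 + r * (2 * c))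
      (2 * ⟪x r - z, w r⟫ + 1 * (2 * c)) (Set.Icc t s) r := fun r hr =>
    ((hx r hr).sub_const z).norm_sq.add ((hasDerivWithinAt_id r _).mul_const (2 * c))
  have hanti : AntitoneOn (fun r => ‖x r - z‖ ^ 2 + r * (2 * c)) (Set.Icc t s) :=
    antitoneOn_of_hasDerivWithinAt_nonpos (convex_Icc t s)
      (fun r hr => (hd r hr).continuousWithinAt)
      (fun r hr => (hd r (interior_subset hr)).mono interior_subset)
      (fun r hr => by have := hw r (interior_subset hr); linarith)
  have h := hanti (Set.left_mem_Icc.2 hts) (Set.right_mem_Icc.2 hts) hts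
  simp only at h
  linarith

/-- The zero set of a maximal monotone operator is closed. -/
lemma isClosed_setOf_zero_mem {H : Type*} [NormedAddCommGroup H] [InnerProductSpace ℝ H]
    {A : H → Set H} (hA : ∀ u v a b : H, u ∈ A a → v ∈ A b → 0 ≤ ⟪u - v, a - b⟫)
    (hAmax : ∀ w u : H, (∀ b v : H, v ∈ A b → 0 ≤ ⟪u - v, w - b⟫) → u ∈ A w) :
    IsClosed {z : H | 0 ∈ A z} := by
  have h : {z : H | 0 ∈ A z} = ⋂ (b : H) (v : H) (_ : v ∈ A b), {z | 0 ≤ ⟪0 - v, z - b⟫} := by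
    ext z
    simp only [Set.mem_ofPred_eq, Set.mem_iInter]
    exact ⟨fun hz b v hv => hA _ _ _ _ hz hv, hAmax z 0⟩
  rw [h]
  exact isClosed_iInter fun b => isClosed_iInter fun v => isClosed_iInter fun _ =>
    isClosed_le continuous_const (by fun_prop)

theorem stmt_8 {H : Type*} [NormedAddCommGroup H] [InnerProductSpace ℝ H] [CompleteSpace H]
    (A : H → Set H)
    (hA : ∀ u v a b : H, u ∈ A a → v ∈ A b → 0 ≤ ⟪u - v, a - b⟫)
    (hAmax : ∀ w u : H, (∀ b v : H, v ∈ A b → 0 ≤ ⟪u - v, w - b⟫) → u ∈ A w)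
    (θ : ℝ) (hθ : 0 < θ)
    (x : ℝ → H) (l : ℝ → ℝ) (y v : ℝ → H)
    (hderiv : ∀ t, 0 ≤ t → HasDerivWithinAt x (y t - x t) (Set.Ici 0) t)
    (hlpos : ∀ t, 0 ≤ t → 0 < l t)
    (hmem : ∀ t, 0 ≤ t → v t ∈ A (y t))
    (heq : ∀ t, 0 ≤ t → l t • v t + y t - x t = 0)
    (hls : ∀ t, 0 ≤ t → l t * ‖y t - x t‖ = θ)
    (hlmono : MonotoneOn l (Set.Ici 0))
    (S : Set H) (hSdef : S = {z : H | 0 ∈ A z}) (hSne : S.Nonempty)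
    (ε κ : ℝ) (hε : 0 < ε) (hκ : 0 < κ)
    (herr : ∀ w u : H, u ∈ A w → ‖u‖ ≤ ε → Metric.infDist w S ≤ κ * ‖u‖) :
    ∃ xstar ∈ S, Filter.Tendsto x Filter.atTop (nhds xstar) ∧
      ∀ α : ℝ, 0 < α → α < 1 →
        ∃ c₀ c₁ c₂ c₃ : ℝ, 0 < c₀ ∧ 0 < c₁ ∧ 0 < c₂ ∧ 0 < c₃ ∧
          ∀ t : ℝ, 0 ≤ t →
            Metric.infDist (x t) S ≤ c₀ * Real.exp (-α * t) ∧
            c₁ * Real.exp (α * t) ≤ l t ∧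
            ‖v t‖ ≤ c₂ * Real.exp (-2 * α * t) ∧
            ‖x t - xstar‖ ≤ c₃ * Real.exp (-α * t) := by
  have hnorm : ∀ t, 0 ≤ t → ‖y t - x t‖ = θ / l t := fun t ht => by
    rw [eq_div_iff (hlpos t ht).ne', mul_comm]; exact hls t ht
  have hyx : ∀ t, 0 ≤ t → y t - x t = -(l t • v t) := fun t ht => by
    rw [eq_neg_iff_add_eq_zero, ← heq t ht]; abel
  have hvnorm : ∀ t, 0 ≤ t → ‖v t‖ = θ / l t ^ 2 := fun t ht => by
    have h := hls t ht
    rw [hyx t ht, norm_neg, norm_smul, Real.norm_of_nonneg (hlpos t ht).le] at h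
    rw [eq_div_iff (pow_ne_zero 2 (hlpos t ht).ne'), ← h]; ring
  -- Fejér monotonicity with a quantitative decrease.
  have hfejer : ∀ z ∈ S, ∀ t s, 0 ≤ t → t ≤ s →
      ‖x s - z‖ ^ 2 + 2 * (s - t) * (θ / l s) ^ 2 ≤ ‖x t - z‖ ^ 2 := by
    intro z hz t s ht hts
    rw [hSdef] at hz
    refine norm_sub_sq_add_le_of_inner_le (w := fun r => y r - x r) hts
      (fun r hr => (hderiv r (ht.trans hr.1)).mono fun q hq => ht.trans hq.1) fun r hr => ?_
    have hr0 : 0 ≤ r := ht.trans hr.1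
    have hm := hA _ _ _ _ (hmem r hr0) hz
    rw [sub_zero] at hm
    have hle : θ / l s ≤ θ / l r := div_le_div_of_nonneg_left hθ.le (hlpos r hr0)
      (hlmono hr0 (ht.trans hts) hr.2)
    have hsq : (θ / l s) ^ 2 ≤ (θ / l r) ^ 2 :=
      pow_le_pow_left₀ (div_nonneg hθ.le (hlpos s (ht.trans hts)).le) hle 2
    have h1 : ⟪x r - z, y r - x r⟫ = ⟪y r - z, y r - x r⟫ - ‖y r - x r‖ ^ 2 := by
      rw [← real_inner_self_eq_norm_sq, ← inner_sub_left]
      congr 1; abel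
    have h2 : ⟪y r - z, y r - x r⟫ = -(l r * ⟪v r, y r - z⟫) := by
      rw [hyx r hr0, inner_neg_right, real_inner_smul_right, real_inner_comm]
    have h3 := mul_nonneg (hlpos r hr0).le hm
    rw [h1, h2, hnorm r hr0]
    linarith
  have hmono : ∀ z ∈ S, ∀ t s, 0 ≤ t → t ≤ s → ‖x s - z‖ ≤ ‖x t - z‖ := by
    intro z hz t s ht hts
    have h := hfejer z hz t s ht hts
    have : 0 ≤ 2 * (s - t) * (θ / l s) ^ 2 :=
      mul_nonneg (by linarith) (sq_nonneg _)
    exact le_of_sq_le_sq (by linarith) (norm_nonneg _)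
  set d : ℝ → ℝ := fun t => Metric.infDist (x t) S with hd
  have hd0 : ∀ t, 0 ≤ d t := fun t => Metric.infDist_nonneg
  have hkey : ∀ t s, 0 ≤ t → t ≤ s → d s ^ 2 + 2 * (s - t) * (θ / l s) ^ 2 ≤ d t ^ 2 := by
    intro t s ht hts
    refine (Real.sqrt_le_left (hd0 t)).1 ((Metric.le_infDist hSne).2 fun z hz => ?_)
    rw [dist_eq_norm]
    refine (Real.sqrt_le_left (norm_nonneg _)).2 (le_trans ?_ (hfejer z hz t s ht hts))
    have : d s ≤ ‖x s - z‖ := by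
      rw [← dist_eq_norm]; exact Metric.infDist_le_dist_of_mem hz
    have := pow_le_pow_left₀ (hd0 s) this 2
    linarith
  have hdanti : ∀ t s, 0 ≤ t → t ≤ s → d s ≤ d t := by
    intro t s ht hts
    have h := hkey t s ht hts
    have : 0 ≤ 2 * (s - t) * (θ / l s) ^ 2 := mul_nonneg (by linarith) (sq_nonneg _)
    exact le_of_sq_le_sq (by linarith) (hd0 t)
  have hxd : ∀ t s, 0 ≤ t → t ≤ s → dist (x t) (x s) ≤ 2 * d t := by
    intro t s ht hts
    suffices dist (x t) (x s) / 2 ≤ d t by linarith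
    refine (Metric.le_infDist hSne).2 fun z hz => ?_
    have h1 := hmono z hz t s ht hts
    rw [← dist_eq_norm, ← dist_eq_norm] at h1
    have h2 := dist_triangle_right (x t) (x s) z
    linarith
  have hld : ∀ t, 0 ≤ t → 2 * θ ^ 2 ≤ (d t * l (t + 1)) ^ 2 := by
    intro t ht
    have h := hkey t (t + 1) ht (by linarith)
    have hl := hlpos (t + 1) (by linarith)
    have h' : 2 * (θ / l (t + 1)) ^ 2 ≤ d t ^ 2 := by nlinarith [sq_nonneg (d (t + 1))]
    rw [div_pow, ← mul_div_assoc, div_le_iff₀ (by positivity)] at h'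
    rw [mul_pow]; exact h'
  have hdpos : 0 < d 0 := by
    refine (hd0 0).lt_of_ne fun h => ?_
    have := hld 0 le_rfl
    rw [← h] at this
    nlinarith
  have hltop : Filter.Tendsto l Filter.atTop Filter.atTop := by
    refine Filter.tendsto_atTop.2 fun M => ?_
    filter_upwards [Filter.eventually_ge_atTop (d 0 ^ 2 * M ^ 2 / (2 * θ ^ 2)),
      Filter.eventually_ge_atTop 0] with t ht ht0
    have h := hkey 0 t le_rfl ht0
    have hl := hlpos t ht0
    have h' : 2 * t * (θ / l t) ^ 2 ≤ d 0 ^ 2 := by nlinarith [sq_nonneg (d t)]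
    rw [div_pow, ← mul_div_assoc, div_le_iff₀ (by positivity)] at h'
    rw [div_le_iff₀ (by positivity)] at ht
    have h2 : d 0 ^ 2 * M ^ 2 ≤ d 0 ^ 2 * l t ^ 2 := by linarith
    exact le_of_sq_le_sq (le_of_mul_le_mul_left h2 (by positivity)) hl.le
  have hdecay : ∀ α : ℝ, 0 < α → α < 1 → ∃ c₀ : ℝ, 0 < c₀ ∧
      ∀ t, 0 ≤ t → d t ≤ c₀ * Real.exp (-α * t) := by
    intro α hα hα1
    have hlim1 : Filter.Tendsto (fun t => θ / l t ^ 2) Filter.atTop (nhds 0) :=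
      ((Filter.tendsto_pow_atTop two_ne_zero).comp hltop).const_div_atTop θ
    have hlim2 : Filter.Tendsto (fun t => α * (κ / l t + 1) ^ 2) Filter.atTop (nhds α) := by
      have := (((hltop.const_div_atTop κ).add_const 1).pow 2).const_mul α
      simpa using this
    obtain ⟨T, hT⟩ := Filter.eventually_atTop.1 ((hlim1.eventually_le_const hε).and
      ((hlim2.eventually_le_const hα1).and (Filter.eventually_ge_atTop 0)))
    have hT0 : 0 ≤ T := (hT T le_rfl).2.2
    have hstep : ∀ t s, T ≤ t → t ≤ s → d s ^ 2 * (1 + 2 * α * (s - t)) ≤ d t ^ 2 := by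
      intro t s ht hts
      obtain ⟨h1, h2, h3⟩ := hT s (ht.trans hts)
      have hl := hlpos s h3
      have hy := herr (y s) (v s) (hmem s h3) ((hvnorm s h3).trans_le h1)
      rw [hvnorm s h3] at hy
      have hds : d s ≤ (κ / l s + 1) * (θ / l s) := by
        have := Metric.infDist_le_infDist_add_dist (s := S) (x := x s) (y := y s)
        rw [dist_comm, dist_eq_norm, hnorm s h3] at this
        have he : (κ / l s + 1) * (θ / l s) = κ * (θ / l s ^ 2) + θ / l s := by
          field_simp
        rw [he]
        exact this.trans (by linarith)
      have hsq := pow_le_pow_left₀ (hd0 s) hds 2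
      have h4 : α * d s ^ 2 ≤ (θ / l s) ^ 2 :=
        calc α * d s ^ 2 ≤ α * ((κ / l s + 1) * (θ / l s)) ^ 2 := by gcongr
          _ = α * (κ / l s + 1) ^ 2 * (θ / l s) ^ 2 := by ring
          _ ≤ 1 * (θ / l s) ^ 2 := by gcongr
          _ = (θ / l s) ^ 2 := one_mul _
      have h5 := hkey t s (hT0.trans ht) hts
      have h6 := mul_le_mul_of_nonneg_left h4 (show 0 ≤ 2 * (s - t) by linarith)
      linarith
    refine ⟨d 0 * Real.exp (α * T), by positivity, fun t ht => ?_⟩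
    rw [mul_assoc, ← Real.exp_add]
    rcases le_total T t with h | h
    · have h1 := mul_exp_le_of_forall_mul_one_add_le (f := fun t => d t ^ 2) (b := 2 * α)
        (by positivity) hstep h
      have h2 : d t ^ 2 * Real.exp (2 * α * (t - T)) = (d t * Real.exp (α * (t - T))) ^ 2 := by
        rw [mul_pow, ← Real.exp_nat_mul]; congr 2; push_cast; ring
      simp only [h2] at h1
      have h3 := (le_of_sq_le_sq h1 (hd0 T)).trans (hdanti 0 T le_rfl hT0)
      have h4 : α * T + -α * t = -(α * (t - T)) := by ring
      rw [h4, Real.exp_neg, ← div_eq_mul_inv, le_div_iff₀ (Real.exp_pos _)]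
      exact h3
    · refine (hdanti 0 t le_rfl ht).trans (le_mul_of_one_le_right (hd0 0) ?_)
      exact Real.one_le_exp (by nlinarith)
  have hdlim : Filter.Tendsto d Filter.atTop (nhds 0) := by
    obtain ⟨c, -, hc⟩ := hdecay (1 / 2) (by norm_num) (by norm_num)
    refine squeeze_zero' (Filter.Eventually.of_forall hd0)
      ((Filter.eventually_ge_atTop 0).mono hc) ?_
    have : Filter.Tendsto (fun t : ℝ => -(1 / 2 : ℝ) * t) Filter.atTop Filter.atBot :=
      Filter.tendsto_id.const_mul_atTop_of_neg (by norm_num)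
    simpa using (Real.tendsto_exp_atBot.comp this).const_mul c
  have hcauchy : Cauchy (Filter.map x Filter.atTop) := by
    refine Metric.cauchy_iff.2 ⟨inferInstance, fun e he => ?_⟩
    obtain ⟨T, hT⟩ := Filter.eventually_atTop.1 ((hdlim.eventually_lt_const
      (show 0 < e / 4 by linarith)).and (Filter.eventually_ge_atTop 0))
    obtain ⟨hT1, hT0⟩ := hT T le_rfl
    refine ⟨x '' Set.Ici T, Filter.image_mem_map (Filter.Ici_mem_atTop T), ?_⟩
    rintro _ ⟨a, ha, rfl⟩ _ ⟨b, hb, rfl⟩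
    have h1 := hxd T a hT0 ha
    have h2 := hxd T b hT0 hb
    have h3 := dist_triangle_left (x a) (x b) (x T)
    linarith
  obtain ⟨p, hp⟩ := CompleteSpace.complete hcauchy
  have hp : Filter.Tendsto x Filter.atTop (nhds p) := hp
  have hpS : p ∈ S := by
    have hclosed : IsClosed S := hSdef ▸ isClosed_setOf_zero_mem hA hAmax
    rw [hclosed.mem_iff_infDist_zero hSne]
    exact tendsto_nhds_unique (((Metric.continuous_infDist_pt S).tendsto p).comp hp) hdlim
  have hxp : ∀ t, 0 ≤ t → ‖x t - p‖ ≤ 2 * d t := by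
    intro t ht
    rw [← dist_eq_norm]
    exact le_of_tendsto (tendsto_const_nhds.dist hp)
      ((Filter.eventually_ge_atTop t).mono fun s hs => hxd t s ht hs)
  refine ⟨p, hpS, hp, fun α hα hα1 => ?_⟩
  obtain ⟨c, hc, hdc⟩ := hdecay α hα hα1
  obtain ⟨c₁, hc₁, hlc⟩ : ∃ c₁ : ℝ, 0 < c₁ ∧ ∀ t, 0 ≤ t → c₁ * Real.exp (α * t) ≤ l t := by
    have hl0 := hlpos 0 le_rfl
    refine ⟨min (l 0) (θ / c) * Real.exp (-α), by positivity, fun t ht => ?_⟩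
    rw [mul_assoc, ← Real.exp_add]
    rcases le_total t 1 with h | h
    · have h1 : Real.exp (-α + α * t) ≤ 1 := Real.exp_le_one_iff.2 (by nlinarith)
      calc min (l 0) (θ / c) * Real.exp (-α + α * t) ≤ l 0 * 1 := by
            gcongr; exact min_le_left _ _
        _ ≤ l t := by rw [mul_one]; exact hlmono Set.self_mem_Ici ht ht
    · have ht1 : 0 ≤ t - 1 := by linarith
      have hl := hlpos t ht
      have h1 := hld (t - 1) ht1
      rw [sub_add_cancel] at h1
      have h2 : θ ≤ d (t - 1) * l t :=
        le_of_sq_le_sq (by nlinarith) (mul_nonneg (hd0 _) hl.le)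
      have h3 : θ ≤ c * Real.exp (-α * (t - 1)) * l t :=
        h2.trans (mul_le_mul_of_nonneg_right (hdc _ ht1) hl.le)
      have h4 : -α * (t - 1) = -(-α + α * t) := by ring
      rw [h4, Real.exp_neg] at h3
      calc min (l 0) (θ / c) * Real.exp (-α + α * t)
          ≤ (c * (Real.exp (-α + α * t))⁻¹ * l t) / c * Real.exp (-α + α * t) := by
            gcongr
            exact (min_le_right _ _).trans (by gcongr)
        _ = l t := by field_simp
  refine ⟨c, c₁, θ / c₁ ^ 2, 2 * c, hc, hc₁, by positivity, by positivity, fun t ht =>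
    ⟨hdc t ht, hlc t ht, ?_, ?_⟩⟩
  · rw [hvnorm t ht]
    calc θ / l t ^ 2 ≤ θ / (c₁ * Real.exp (α * t)) ^ 2 := by gcongr; exact hlc t ht
      _ = θ / c₁ ^ 2 * Real.exp (-2 * α * t) := by
        have : -2 * α * t = -((2 : ℕ) * (α * t)) := by push_cast; ring
        rw [this, Real.exp_neg, Real.exp_nat_mul, mul_pow]
        field_simp
  · have h1 := hxp t ht
    have h2 := hdc t ht
    rw [mul_assoc]
    linarith
end

section
/- Let H be a real Hilbert space, A : H → Set H a maximal monotone operator, θ > 0, and let (x, λ, y, v) be a solution of the system (LSP) on [0, ∞) with λ nondecreasing. Assume that the set A⁻¹(0) has nonempty interior: there exist p ∈ H and r > 0 such that the closed ball of radius r centered at p is contained in A⁻¹(0). Then x(t) converges strongly (in norm) as t → ∞ to some x* ∈ A⁻¹(0). -/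
open RealInnerProductSpace

/-- A curve whose speed is dominated by the decay rate of a function `B` moves at most as far as `B`
decreases. -/
lemma norm_sub_le_of_norm_deriv_le_neg_deriv {E : Type*} [NormedAddCommGroup E] [NormedSpace ℝ E]
    {f f' : ℝ → E} {B B' : ℝ → ℝ}
    (hf : ∀ t, 0 ≤ t → HasDerivWithinAt f (f' t) (Set.Ici 0) t)
    (hB : ∀ t, 0 ≤ t → HasDerivWithinAt B (B' t) (Set.Ici 0) t)
    {a b : ℝ} (ha : 0 ≤ a) (hab : a ≤ b) (hle : ∀ t ∈ Set.Ico a b, ‖f' t‖ ≤ -B' t) :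
    ‖f b - f a‖ ≤ B a - B b := by
  have hpos : ∀ t ∈ Set.Icc a b, 0 ≤ t := fun t ht => ha.trans ht.1
  have hsub : Set.Icc a b ⊆ Set.Ici 0 := hpos
  refine image_norm_le_of_norm_deriv_right_le_deriv_boundary'
    (f := fun t => f t - f a) (f' := f') (B := fun t => B a - B t) (B' := fun t => -B' t)
    (a := a) (b := b) ?_ ?_ (by simp) ?_ ?_ hle ⟨hab, le_rfl⟩
  · exact ContinuousOn.sub
      (fun t ht => (hf t (hpos t ht)).continuousWithinAt.mono hsub) continuousOn_const
  · intro t ht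
    have h0 : 0 ≤ t := ha.trans ht.1
    exact ((hf t h0).mono (Set.Ici_subset_Ici.2 h0)).sub_const _
  · exact ContinuousOn.sub continuousOn_const
      (fun t ht => (hB t (hpos t ht)).continuousWithinAt.mono hsub)
  · intro t ht
    have h0 : 0 ≤ t := ha.trans ht.1
    exact ((hB t h0).mono (Set.Ici_subset_Ici.2 h0)).const_sub _

/-- A curve whose increments are bounded by the decrease of a nonnegative function is Cauchy. -/
lemma cauchySeq_of_norm_sub_le_sub {E : Type*} [NormedAddCommGroup E] {f : ℝ → E} {B : ℝ → ℝ}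
    (hB : ∀ t, 0 ≤ B t) (h : ∀ a b, 0 ≤ a → a ≤ b → ‖f b - f a‖ ≤ B a - B b) :
    CauchySeq f := by
  rw [Metric.cauchySeq_iff']
  intro ε hε
  have hbdd : BddBelow (B '' Set.Ici 0) := ⟨0, by rintro _ ⟨t, -, rfl⟩; exact hB t⟩
  obtain ⟨_, ⟨s, hs, rfl⟩, hlt⟩ := Real.lt_sInf_add_pos
    (s := B '' Set.Ici 0) ⟨B 0, 0, by simp, rfl⟩ hε
  refine ⟨s, fun t hst => ?_⟩
  have hinf := csInf_le hbdd ⟨t, (Set.mem_Ici.1 hs).trans hst, rfl⟩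
  rw [dist_eq_norm]
  linarith [h s t hs hst]

/-- If `w` makes a nonnegative angle with `y - z` for every `z` in a ball, then it makes a
uniformly acute angle with `y` minus the centre. -/
lemma mul_norm_le_inner_of_forall_closedBall {H : Type*} [NormedAddCommGroup H]
    [InnerProductSpace ℝ H] {w y p : H} {r : ℝ} (hr : 0 ≤ r)
    (h : ∀ z ∈ Metric.closedBall p r, 0 ≤ ⟪w, y - z⟫) : r * ‖w‖ ≤ ⟪w, y - p⟫ := by
  rcases eq_or_ne w 0 with rfl | hw
  · simp
  have hn : ‖w‖ ≠ 0 := norm_ne_zero_iff.2 hw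
  have key := h (p + (r / ‖w‖) • w) (by
    rw [mem_closedBall_iff_norm, add_sub_cancel_left, norm_smul, Real.norm_of_nonneg (by positivity),
      div_mul_cancel₀ _ hn])
  rw [← sub_sub, inner_sub_right, inner_smul_right, real_inner_self_eq_norm_sq] at key
  have : r / ‖w‖ * ‖w‖ ^ 2 = r * ‖w‖ := by field_simp
  linarith

/-- The graph of a maximal monotone operator is sequentially closed. -/
lemma mem_of_tendsto_of_maximal_monotone {H ι : Type*} [NormedAddCommGroup H]
    [InnerProductSpace ℝ H] {A : H → Set H}
    (hA : ∀ u v a b : H, u ∈ A a → v ∈ A b → 0 ≤ ⟪u - v, a - b⟫)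
    (hAmax : ∀ w u : H, (∀ b v : H, v ∈ A b → 0 ≤ ⟪u - v, w - b⟫) → u ∈ A w)
    {F : Filter ι} [F.NeBot] {y v : ι → H} {a u : H} (hmem : ∀ᶠ t in F, v t ∈ A (y t))
    (hy : Filter.Tendsto y F (nhds a)) (hv : Filter.Tendsto v F (nhds u)) : u ∈ A a := by
  refine hAmax a u fun b w hw => ?_
  refine ge_of_tendsto ((hv.sub_const w).inner (hy.sub_const b)) ?_
  filter_upwards [hmem] with t ht using hA _ _ _ _ ht hw

theorem stmt_9 {H : Type*} [NormedAddCommGroup H] [InnerProductSpace ℝ H] [CompleteSpace H]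
    (A : H → Set H)
    (hA : ∀ u v a b : H, u ∈ A a → v ∈ A b → 0 ≤ ⟪u - v, a - b⟫)
    (hAmax : ∀ w u : H, (∀ b v : H, v ∈ A b → 0 ≤ ⟪u - v, w - b⟫) → u ∈ A w)
    (θ : ℝ) (hθ : 0 < θ)
    (x : ℝ → H) (l : ℝ → ℝ) (y v : ℝ → H)
    (hderiv : ∀ t, 0 ≤ t → HasDerivWithinAt x (y t - x t) (Set.Ici 0) t)
    (hlpos : ∀ t, 0 ≤ t → 0 < l t)
    (hmem : ∀ t, 0 ≤ t → v t ∈ A (y t))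
    (heq : ∀ t, 0 ≤ t → l t • v t + y t - x t = 0)
    (hls : ∀ t, 0 ≤ t → l t * ‖y t - x t‖ = θ)
    (hlmono : MonotoneOn l (Set.Ici 0))
    (p : H) (r : ℝ) (hr : 0 < r)
    (hint : Metric.closedBall p r ⊆ {z : H | 0 ∈ A z}) :
    ∃ xstar : H, 0 ∈ A xstar ∧ Filter.Tendsto x Filter.atTop (nhds xstar) := by
  have hspeed : ∀ t, 0 ≤ t → 2 * r * ‖y t - x t‖ ≤ -(2 * ⟪x t - p, y t - x t⟫) := by
    intro t ht
    have hw : x t - y t = l t • v t := by rw [← sub_eq_zero, ← neg_eq_zero, ← heq t ht]; abel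
    have h1 : r * ‖x t - y t‖ ≤ ⟪x t - y t, y t - p⟫ :=
      mul_norm_le_inner_of_forall_closedBall hr.le fun z hz => by
        have := hA _ _ _ _ (hmem t ht) (hint hz)
        rw [sub_zero] at this
        rw [hw, real_inner_smul_left]
        exact mul_nonneg (hlpos t ht).le this
    have h2 : -⟪x t - p, y t - x t⟫ = ‖x t - y t‖ ^ 2 + ⟪x t - y t, y t - p⟫ := by
      rw [← real_inner_self_eq_norm_sq, ← inner_add_right, ← inner_neg_right, neg_sub,
        real_inner_comm, sub_add_sub_cancel]
    rw [norm_sub_rev]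
    nlinarith [sq_nonneg ‖x t - y t‖]
  have hB : ∀ t, 0 ≤ t → HasDerivWithinAt (fun s => ‖x s - p‖ ^ 2)
      (2 * ⟪x t - p, y t - x t⟫) (Set.Ici 0) t := fun t ht => ((hderiv t ht).sub_const p).norm_sq
  have hcauchy : CauchySeq fun t => (2 * r) • x t := by
    refine cauchySeq_of_norm_sub_le_sub (B := fun s => ‖x s - p‖ ^ 2) (fun _ => by positivity)
      fun a b ha hab => ?_
    refine norm_sub_le_of_norm_deriv_le_neg_deriv
      (fun t ht => (hderiv t ht).const_smul (2 * r)) hB ha hab fun t ht => ?_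
    rw [norm_smul, Real.norm_of_nonneg (by positivity)]
    exact hspeed t (ha.trans ht.1)
  obtain ⟨c, hc⟩ := cauchySeq_tendsto_of_complete hcauchy
  have hx : Filter.Tendsto x Filter.atTop (nhds ((2 * r)⁻¹ • c)) := by
    refine (hc.const_smul (2 * r)⁻¹).congr fun t => ?_
    rw [inv_smul_smul₀ (by positivity)]
  have hnorm : ∀ t, 0 ≤ t → ‖y t - x t‖ = θ / l t := fun t ht => by
    rw [eq_div_iff (hlpos t ht).ne', mul_comm, hls t ht]
  have hdecay : ∀ t, 0 < t → ‖y t - x t‖ ≤ ‖x 0 - p‖ ^ 2 / (2 * r) / t := by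
    intro t ht
    have h := norm_sub_le_of_norm_deriv_le_neg_deriv
      (f := fun s => s * (2 * r * ‖y t - x t‖)) (f' := fun _ => 1 * (2 * r * ‖y t - x t‖))
      (fun s _ => (hasDerivWithinAt_id s _).mul_const _) hB le_rfl ht.le fun s hs => by
        have hle : ‖y t - x t‖ ≤ ‖y s - x s‖ := by
          rw [hnorm t ht.le, hnorm s hs.1]
          exact div_le_div_of_nonneg_left hθ.le (hlpos s hs.1) (hlmono hs.1 ht.le hs.2.le)
        rw [one_mul, Real.norm_of_nonneg (by positivity)]
        exact (mul_le_mul_of_nonneg_left hle (by positivity)).trans (hspeed s hs.1)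
    rw [zero_mul, sub_zero, Real.norm_of_nonneg (by positivity)] at h
    rw [div_div, le_div_iff₀ (by positivity)]
    nlinarith [sq_nonneg ‖x t - p‖]
  have hyx : Filter.Tendsto (fun t => y t - x t) Filter.atTop (nhds 0) :=
    squeeze_zero_norm' ((Filter.eventually_gt_atTop 0).mono hdecay)
      (tendsto_const_nhds.div_atTop Filter.tendsto_id)
  have hy : Filter.Tendsto y Filter.atTop (nhds ((2 * r)⁻¹ • c)) := by
    simpa using hyx.add hx
  have hv : Filter.Tendsto v Filter.atTop (nhds 0) := by
    refine squeeze_zero_norm' (a := fun t => ‖y t - x t‖ / l 0) ?_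
      (by simpa using hyx.norm.div_const (l 0))
    filter_upwards [Filter.eventually_ge_atTop 0] with t ht
    have hw : y t - x t = -(l t • v t) := by rw [← sub_eq_zero, ← heq t ht]; abel
    rw [le_div_iff₀ (hlpos 0 le_rfl), hw, norm_neg, norm_smul,
      Real.norm_of_nonneg (hlpos t ht).le, mul_comm]
    exact mul_le_mul_of_nonneg_right (hlmono Set.self_mem_Ici ht ht) (norm_nonneg _)
  exact ⟨_, mem_of_tendsto_of_maximal_monotone hA hAmax
    ((Filter.eventually_ge_atTop 0).mono hmem) hy hv, hx⟩
end

section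
/- Let H be a real Hilbert space, f : H → ℝ a convex function, θ > 0, and let (x, λ, y, v) be a solution of the system (LSP) on [0, ∞) for the operator A = ∂f, with λ nondecreasing. Let z̄ ∈ H be a global minimizer of f with x(0) ≠ z̄, set d₀ = ‖x(0) − z̄‖ and κ = √(θ/d₀³). Then for every t ≥ 0, f(y(t)) ≤ f(x(t)) − κ·(f(x(t)) − f(z̄))^{3/2} / (1 + (3κ/2)·(f(x(t)) − f(z̄))^{1/2}). -/
open RealInnerProductSpace

theorem le_sub_div_of_add_mul_cube_le {a b κ : ℝ} (ha : 0 ≤ a) (hb : 0 ≤ b) (hκ : 0 ≤ κ)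
    (h : a + κ * √a ^ 3 ≤ b) :
    a ≤ b - κ * b ^ ((3 : ℝ) / 2) / (1 + (3 * κ / 2) * b ^ ((1 : ℝ) / 2)) := by
  have hp := Real.sqrt_nonneg a
  have hq := Real.sqrt_nonneg b
  have hb3 : b ^ ((3 : ℝ) / 2) = √b ^ 3 := by
    rw [Real.sqrt_eq_rpow, ← Real.rpow_natCast, ← Real.rpow_mul hb]
    norm_num
  rw [hb3, ← Real.sqrt_eq_rpow, le_sub_comm, div_le_iff₀ (by positivity)]
  have tangent : 0 ≤ κ * ((√a - √b) ^ 2 * (√a + √b / 2)) := by positivity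
  have hab : (b - a) * √b = √b ^ 3 - √a ^ 2 * √b := by
    rw [Real.sq_sqrt ha, pow_succ, Real.sq_sqrt hb]
    ring
  linear_combination h + tangent - 3 * κ / 2 * hab

theorem mul_sqrt_cube_le {a d l n κ : ℝ} (ha : 0 ≤ a) (hd : 0 < d) (hl : 0 ≤ l)
    (hn : 0 ≤ n) (hκ : κ = √(l ^ 2 * n / d ^ 3)) (h : a ≤ n * d) :
    κ * √a ^ 3 ≤ l * n ^ 2 := by
  refine le_of_sq_le_sq ?_ (by positivity)
  calc (κ * √a ^ 3) ^ 2 = κ ^ 2 * (√a ^ 2) ^ 3 := by ring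
    _ = l ^ 2 * n / d ^ 3 * a ^ 3 := by rw [Real.sq_sqrt ha, hκ, Real.sq_sqrt (by positivity)]
    _ ≤ l ^ 2 * n / d ^ 3 * (n * d) ^ 3 := by gcongr
    _ = (l * n ^ 2) ^ 2 := by field_simp

theorem norm_sub_le_of_inner_deriv_nonpos {H : Type*} [NormedAddCommGroup H]
    [InnerProductSpace ℝ H] {x x' : ℝ → H} {z : H}
    (hx : ∀ t, 0 ≤ t → HasDerivWithinAt x (x' t) (Set.Ici 0) t)
    (h : ∀ t, 0 ≤ t → ⟪x t - z, x' t⟫ ≤ 0) {t : ℝ} (ht : 0 ≤ t) :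
    ‖x t - z‖ ≤ ‖x 0 - z‖ := by
  have hd : ∀ s, 0 ≤ s → HasDerivWithinAt (fun s => ‖x s - z‖ ^ 2)
      (2 * ⟪x s - z, x' s⟫) (Set.Ici 0) s := fun s hs => ((hx s hs).sub_const z).norm_sq
  have hanti : AntitoneOn (fun s => ‖x s - z‖ ^ 2) (Set.Ici 0) := by
    refine antitoneOn_of_hasDerivWithinAt_nonpos (convex_Ici 0)
      (fun s hs => (hd s hs).continuousWithinAt)
      (fun s hs => (hd s (interior_subset hs)).mono interior_subset)
      (fun s hs => ?_)
    linarith [h s (interior_subset hs)]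
  exact le_of_sq_le_sq (hanti Set.self_mem_Ici ht ht) (norm_nonneg _)

theorem stmt_11 {H : Type*} [NormedAddCommGroup H] [InnerProductSpace ℝ H] [CompleteSpace H]
    (f : H → ℝ) (hf : ConvexOn ℝ Set.univ f)
    (θ : ℝ) (hθ : 0 < θ)
    (x : ℝ → H) (l : ℝ → ℝ) (y v : ℝ → H)
    (hderiv : ∀ t, 0 ≤ t → HasDerivWithinAt x (y t - x t) (Set.Ici 0) t)
    (hlpos : ∀ t, 0 ≤ t → 0 < l t)
    (hsub : ∀ t, 0 ≤ t → ∀ z : H, f (y t) + ⟪v t, z - y t⟫ ≤ f z)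
    (heq : ∀ t, 0 ≤ t → l t • v t + y t - x t = 0)
    (hls : ∀ t, 0 ≤ t → l t * ‖y t - x t‖ = θ)
    (hlmono : MonotoneOn l (Set.Ici 0))
    (zbar : H) (hzbar : ∀ w : H, f zbar ≤ f w) (hx0 : x 0 ≠ zbar)
    (d₀ κ : ℝ) (hd₀ : d₀ = ‖x 0 - zbar‖) (hκ : κ = Real.sqrt (θ / d₀ ^ 3)) :
    ∀ t : ℝ, 0 ≤ t →
      f (y t) ≤ f (x t) -
        κ * (f (x t) - f zbar) ^ ((3 : ℝ) / 2) /
          (1 + (3 * κ / 2) * (f (x t) - f zbar) ^ ((1 : ℝ) / 2)) := by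
  intro t ht
  have hxy : ∀ s, 0 ≤ s → x s - y s = l s • v s := fun s hs => by
    rw [← sub_eq_zero, ← neg_eq_zero, ← heq s hs]
    abel
  have hgap : ∀ s, 0 ≤ s → f (y s) - f zbar ≤ ⟪v s, y s - zbar⟫ := fun s hs => by
    have h := hsub s hs zbar
    rw [← neg_sub, inner_neg_right] at h
    linarith
  have hsplit : ∀ s, 0 ≤ s →
      ⟪v s, x s - zbar⟫ = ⟪v s, y s - zbar⟫ + l s * ‖v s‖ ^ 2 := fun s hs => by
    rw [← sub_add_sub_cancel' (y s) zbar (x s), hxy s hs, inner_add_right,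
      real_inner_smul_right, real_inner_self_eq_norm_sq]
  have hdist : ‖x t - zbar‖ ≤ d₀ := by
    rw [hd₀]
    refine norm_sub_le_of_inner_deriv_nonpos hderiv (fun s hs => ?_) ht
    rw [← neg_sub (x s), hxy s hs, inner_neg_right, real_inner_smul_right, real_inner_comm,
      hsplit s hs]
    have := hlpos s hs
    have : 0 ≤ ⟪v s, y s - zbar⟫ := by linarith [hgap s hs, hzbar (y s)]
    exact neg_nonpos.2 (by positivity)
  have hlt := hlpos t ht
  have hθt : θ = l t ^ 2 * ‖v t‖ := by
    rw [← hls t ht, norm_sub_rev, hxy t ht, norm_smul, Real.norm_of_nonneg hlt.le]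
    ring
  have hd₀pos : 0 < d₀ := hd₀ ▸ norm_pos_iff.2 (sub_ne_zero.2 hx0)
  have ha : f (y t) - f zbar ≤ ‖v t‖ * d₀ := by
    have hcs := real_inner_le_norm (v t) (x t - zbar)
    have hmul := mul_le_mul_of_nonneg_left hdist (norm_nonneg (v t))
    have : 0 ≤ l t * ‖v t‖ ^ 2 := by positivity
    linarith [hgap t ht, hsplit t ht]
  have hdecr : f (y t) + l t * ‖v t‖ ^ 2 ≤ f (x t) := by
    have h := hsub t ht (x t)
    rwa [hxy t ht, real_inner_smul_right, real_inner_self_eq_norm_sq] at h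
  have ha0 : 0 ≤ f (y t) - f zbar := sub_nonneg.2 (hzbar _)
  have hcube := mul_sqrt_cube_le ha0 hd₀pos hlt.le (norm_nonneg (v t)) (hθt ▸ hκ) ha
  have hmain := le_sub_div_of_add_mul_cube_le ha0 (sub_nonneg.2 (hzbar (x t)))
    (hκ ▸ Real.sqrt_nonneg _) (by linarith : _ ≤ f (x t) - f zbar)
  linarith
end

section
/- Let H be a real Hilbert space, f : H → ℝ a convex function, θ > 0, and let (x, λ, y, v) be a solution of the system (LSP) on [0, ∞) for the operator A = ∂f, with x and λ continuous. Let z ∈ H be a global minimizer of f. Then for every T > 0, the integral ∫₀^T λ(t)·(f(y(t)) − f(z)) dt ≤ (1/2)·‖x(0) − z‖². -/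
open RealInnerProductSpace

theorem stmt_13 {H : Type*} [NormedAddCommGroup H] [InnerProductSpace ℝ H] [CompleteSpace H]
    (f : H → ℝ) (hf : ConvexOn ℝ Set.univ f)
    (θ : ℝ) (hθ : 0 < θ)
    (x : ℝ → H) (l : ℝ → ℝ) (y v : ℝ → H)
    (hderiv : ∀ t, 0 ≤ t → HasDerivWithinAt x (y t - x t) (Set.Ici 0) t)
    (hlpos : ∀ t, 0 ≤ t → 0 < l t)
    (hsub : ∀ t, 0 ≤ t → ∀ z : H, f (y t) + ⟪v t, z - y t⟫ ≤ f z)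
    (heq : ∀ t, 0 ≤ t → l t • v t + y t - x t = 0)
    (hls : ∀ t, 0 ≤ t → l t * ‖y t - x t‖ = θ)
    (hxcont : Continuous x) (hlcont : Continuous l)
    (z : H) (hz : ∀ w : H, f z ≤ f w) :
    ∀ T : ℝ, 0 < T →
      ∫ t in (0 : ℝ)..T, l t * (f (y t) - f z) ≤ (1 / 2) * ‖x 0 - z‖ ^ 2 := by
  intro T hT
  by_cases hint : IntervalIntegrable (fun t => l t * (f (y t) - f z)) MeasureTheory.volume 0 T
  swap
  · rw [intervalIntegral.integral_undef hint]
    positivity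
  have henergy : ∀ t ∈ Set.Ioo 0 T, HasDerivWithinAt (fun t => -((1 / 2) * ‖x t - z‖ ^ 2))
      (-⟪x t - z, y t - x t⟫) (Set.Ioi t) t := by
    intro t ht
    have h := (((hderiv t ht.1.le).mono fun s hs => (ht.1.trans hs).le).sub_const z).norm_sq
    exact (h.const_mul (1 / 2)).neg.congr_deriv (by ring)
  have hle : ∀ t ∈ Set.Ioo 0 T, l t * (f (y t) - f z) ≤ -⟪x t - z, y t - x t⟫ := by
    intro t ht
    have hyx : y t - x t = -(l t • v t) := by
      linear_combination (norm := module) heq t ht.1.le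
    have hx : x t - z = l t • v t - (z - y t) := by
      linear_combination (norm := module) -heq t ht.1.le
    have hgap : f (y t) - f z ≤ -⟪v t, z - y t⟫ := by
      linarith [hsub t ht.1.le z]
    rw [hyx, hx, inner_neg_right, neg_neg, inner_sub_left, real_inner_self_eq_norm_sq,
      real_inner_smul_right, real_inner_comm]
    nlinarith [mul_le_mul_of_nonneg_left hgap (hlpos t ht.1.le).le, sq_nonneg ‖l t • v t‖]
  have h := intervalIntegral.integral_le_sub_of_hasDeriv_right_of_le hT.le
    (by fun_prop) henergy
    ((intervalIntegrable_iff_integrableOn_Icc_of_le hT.le).1 hint) hle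
  have hnonneg : 0 ≤ (1 / 2) * ‖x T - z‖ ^ 2 := by positivity
  linarith
end

section
/- Let a, b, c be non-negative real numbers such that a ≥ b + c·b^{3/2}. Then b ≤ a − c·a^{3/2}/(1 + (3c/2)·a^{1/2}). -/
theorem Real.rpow_three_halves_eq_sqrt_pow {x : ℝ} (hx : 0 ≤ x) :
    x ^ ((3 : ℝ) / 2) = √x ^ 3 := by
  rw [Real.sqrt_eq_rpow, ← Real.rpow_natCast, ← Real.rpow_mul hx]
  norm_num

theorem stmt_14 (a b c : ℝ) (ha : 0 ≤ a) (hb : 0 ≤ b) (hc : 0 ≤ c)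
    (h : b + c * b ^ ((3 : ℝ) / 2) ≤ a) :
    b ≤ a - c * a ^ ((3 : ℝ) / 2) / (1 + (3 * c / 2) * a ^ ((1 : ℝ) / 2)) := by
  rw [Real.rpow_three_halves_eq_sqrt_pow hb] at h
  rw [Real.rpow_three_halves_eq_sqrt_pow ha, ← Real.sqrt_eq_rpow, le_sub_comm,
    div_le_iff₀ (by positivity)]
  have hs : √a ^ 2 = a := Real.sq_sqrt ha
  have ht : √b ^ 2 = b := Real.sq_sqrt hb
  have tangent : 0 ≤ c * ((√b - √a) ^ 2 * (√b + √a / 2)) := by positivity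
  have expand : c * ((√b - √a) ^ 2 * (√b + √a / 2)) =
      c * √b ^ 3 + 3 * c / 2 * √a * (√a ^ 2 - √b ^ 2) - c * √a ^ 3 := by ring
  rw [expand, hs, ht] at tangent
  linarith
end

section
/- Let H be a real Hilbert space and f : H → ℝ a convex function. Let x ∈ H, λ > 0, σ ∈ [0, 1), ε ≥ 0, and y, v ∈ H satisfy v ∈ ∂_ε f(y) and ‖λ·v + y − x‖² + 2λε ≤ σ²·‖y − x‖². Then: (a) f(x) ≥ f(y) + (λ/2)·‖v‖² + ((1 − σ²)/(2λ))·‖y − x‖² ≥ f(y); (b) (1 − σ)·‖y − x‖ ≤ λ·‖v‖ ≤ (1 + σ)·‖y − x‖; (c) ε ≤ (σ²/(2(1 − σ)))·‖v‖·‖y − x‖; and (d) (λ/2)·‖v‖² + ((1 − σ²)/(2λ))·‖y − x‖² ≥ max{ ‖v‖^{3/2}·√(λ·‖y − x‖·(1 − σ)), ((1 − σ)/λ)·‖y − x‖² }. -/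
open RealInnerProductSpace

theorem stmt_16 {H : Type*} [NormedAddCommGroup H] [InnerProductSpace ℝ H] [CompleteSpace H]
    (f : H → ℝ) (hf : ConvexOn ℝ Set.univ f)
    (x y v : H) (l σ ε : ℝ) (hl : 0 < l) (hσ0 : 0 ≤ σ) (hσ1 : σ < 1) (hε : 0 ≤ ε)
    (hsub : ∀ z : H, f y + ⟪v, z - y⟫ - ε ≤ f z)
    (herr : ‖l • v + y - x‖ ^ 2 + 2 * l * ε ≤ σ ^ 2 * ‖y - x‖ ^ 2) :
    (f y + (l / 2) * ‖v‖ ^ 2 + ((1 - σ ^ 2) / (2 * l)) * ‖y - x‖ ^ 2 ≤ f x ∧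
      f y ≤ f y + (l / 2) * ‖v‖ ^ 2 + ((1 - σ ^ 2) / (2 * l)) * ‖y - x‖ ^ 2) ∧
    ((1 - σ) * ‖y - x‖ ≤ l * ‖v‖ ∧ l * ‖v‖ ≤ (1 + σ) * ‖y - x‖) ∧
    ε ≤ (σ ^ 2 / (2 * (1 - σ))) * ‖v‖ * ‖y - x‖ ∧
    max (‖v‖ ^ ((3 : ℝ) / 2) * Real.sqrt (l * ‖y - x‖ * (1 - σ)))
        (((1 - σ) / l) * ‖y - x‖ ^ 2) ≤
      (l / 2) * ‖v‖ ^ 2 + ((1 - σ ^ 2) / (2 * l)) * ‖y - x‖ ^ 2 := by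
  have hd : 0 ≤ ‖y - x‖ := norm_nonneg _
  have hn : 0 ≤ ‖v‖ := norm_nonneg _
  have hlv : ‖l • v‖ = l * ‖v‖ := by rw [norm_smul, Real.norm_of_nonneg hl.le]
  have hexp : ‖l • v + y - x‖ ^ 2 = (l * ‖v‖) ^ 2 + 2 * (l * ⟪v, y - x⟫) + ‖y - x‖ ^ 2 := by
    rw [add_sub_assoc, norm_add_sq_real, hlv, real_inner_smul_left]
  have hres : ‖l • v + y - x‖ ≤ σ * ‖y - x‖ := by
    refine le_of_sq_le_sq ?_ (by positivity)
    nlinarith [mul_nonneg hl.le hε]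
  have hlow : (1 - σ) * ‖y - x‖ ≤ l * ‖v‖ := by
    have h := norm_sub_le (l • v + y - x) (l • v)
    rw [show l • v + y - x - l • v = y - x by abel, hlv] at h
    linarith
  have hupp : l * ‖v‖ ≤ (1 + σ) * ‖y - x‖ := by
    have h := norm_sub_le (l • v + y - x) (y - x)
    rw [show l • v + y - x - (y - x) = l • v by abel, hlv] at h
    linarith
  have hσ : 0 < 1 - σ := sub_pos.2 hσ1
  have hσsq : 0 ≤ 1 - σ ^ 2 := by nlinarith
  have hsum : (l / 2) * ‖v‖ ^ 2 + ((1 - σ ^ 2) / (2 * l)) * ‖y - x‖ ^ 2 =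
      ((l * ‖v‖) ^ 2 + (1 - σ ^ 2) * ‖y - x‖ ^ 2) / (2 * l) := by
    field_simp
  refine ⟨⟨?_, ?_⟩, ⟨hlow, hupp⟩, ?_, max_le ?_ ?_⟩
  · have hx := hsub x
    rw [← neg_sub y x, inner_neg_right] at hx
    have h : ((l * ‖v‖) ^ 2 + (1 - σ ^ 2) * ‖y - x‖ ^ 2) / (2 * l) ≤ -⟪v, y - x⟫ - ε := by
      rw [div_le_iff₀ (by positivity)]
      linarith
    linarith
  · have : 0 ≤ (l / 2) * ‖v‖ ^ 2 + ((1 - σ ^ 2) / (2 * l)) * ‖y - x‖ ^ 2 := by positivity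
    linarith
  · have h : (σ ^ 2 * ‖y - x‖) * ((1 - σ) * ‖y - x‖) ≤ (σ ^ 2 * ‖y - x‖) * (l * ‖v‖) :=
      mul_le_mul_of_nonneg_left hlow (by positivity)
    have hε' : 2 * l * ε ≤ σ ^ 2 * ‖y - x‖ ^ 2 := by
      linarith [sq_nonneg ‖l • v + y - x‖]
    rw [div_mul_eq_mul_div, div_mul_eq_mul_div, le_div_iff₀ (by positivity)]
    refine le_of_mul_le_mul_left ?_ hl
    linarith [mul_le_mul_of_nonneg_left hε' hσ.le]
  · have hpow : ‖v‖ ^ ((3 : ℝ) / 2) = ‖v‖ * √‖v‖ := by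
      rw [show (3 : ℝ) / 2 = 1 + 1 / 2 by norm_num,
        Real.rpow_add_of_nonneg hn (by norm_num) (by norm_num), Real.rpow_one,
        Real.sqrt_eq_rpow]
    rw [hpow, mul_assoc, ← Real.sqrt_mul hn, hsum, le_div_iff₀ (by positivity)]
    have hr := Real.sq_sqrt (show 0 ≤ ‖v‖ * (l * ‖y - x‖ * (1 - σ)) by positivity)
    have h : ((1 - σ) * ‖y - x‖) * (l * ‖v‖) ≤ ((1 - σ) * ‖y - x‖) * ((1 + σ) * ‖y - x‖) :=
      mul_le_mul_of_nonneg_left hupp (by positivity)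
    nlinarith [sq_nonneg (l * ‖v‖ - √(‖v‖ * (l * ‖y - x‖ * (1 - σ))))]
  · rw [hsum, le_div_iff₀ (by positivity)]
    have h : ((1 - σ) * ‖y - x‖) ^ 2 ≤ (l * ‖v‖) ^ 2 := by gcongr
    rw [show (1 - σ) / l * ‖y - x‖ ^ 2 * (2 * l) = 2 * (1 - σ) * ‖y - x‖ ^ 2 by field_simp]
    linarith
end

section
/- Let H be a real Hilbert space, f : H → ℝ a convex function bounded below, σ ∈ [0, 1), and θ > 0. Let (x_k)_{k ≥ 0} in H, (v_k)_{k ≥ 1} in H, (ε_k)_{k ≥ 1} and (λ_k)_{k ≥ 1} in ℝ satisfy, for every k ≥ 1: ε_k ≥ 0, λ_k > 0, v_k ∈ ∂_{ε_k} f(x_k), ‖λ_k·v_k + x_k − x_{k−1}‖² + 2λ_k·ε_k ≤ σ²·‖x_k − x_{k−1}‖², and λ_k·‖x_k − x_{k−1}‖ ≥ θ. Then the series Σ_k 1/λ_k³ converges; in particular λ_k → ∞ as k → ∞. -/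
open RealInnerProductSpace

/-- If each nonnegative term is at most the decrease of a sequence bounded below, the series
converges. -/
theorem summable_of_le_sub_of_bddBelow {a g : ℕ → ℝ} (ha : ∀ n, 0 ≤ a n)
    (hag : ∀ n, a n ≤ g n - g (n + 1)) (hg : BddBelow (Set.range g)) : Summable a := by
  obtain ⟨m, hm⟩ := hg
  refine summable_of_sum_range_le (c := g 0 - m) ha fun n => ?_
  calc ∑ i ∈ Finset.range n, a i ≤ ∑ i ∈ Finset.range n, (g i - g (i + 1)) :=
        Finset.sum_le_sum fun i _ => hag i
    _ = g 0 - g n := Finset.sum_range_sub' g n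
    _ ≤ g 0 - m := by linarith [hm ⟨n, rfl⟩]

/-- Objective decrease of an inexact proximal step: the relative error criterion gives
`(1 - σ²) ‖y - x‖² / 2 ≤ l (f x - f y)`. -/
theorem inexact_proximal_step_decrease {H : Type*} [NormedAddCommGroup H] [InnerProductSpace ℝ H]
    {f : H → ℝ} {x y v : H} {σ ε l : ℝ} (hl : 0 < l)
    (hsub : f y + ⟪v, x - y⟫ - ε ≤ f x)
    (herr : ‖l • v + y - x‖ ^ 2 + 2 * l * ε ≤ σ ^ 2 * ‖y - x‖ ^ 2) :
    (1 - σ ^ 2) * ‖y - x‖ ^ 2 / 2 ≤ l * (f x - f y) := by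
  have hexp : ‖l • v + y - x‖ ^ 2 = ‖l • v‖ ^ 2 + 2 * (l * ⟪v, y - x⟫) + ‖y - x‖ ^ 2 := by
    rw [add_sub_assoc, norm_add_sq_real, real_inner_smul_left]
  have hneg : ⟪v, x - y⟫ = -⟪v, y - x⟫ := by rw [← inner_neg_right, neg_sub]
  rw [hneg] at hsub
  rw [hexp] at herr
  have hmul := mul_le_mul_of_nonneg_left hsub hl.le
  linarith [sq_nonneg ‖l • v‖]

/-- An eventually positive sequence whose inverse powers are null tends to infinity. -/
theorem tendsto_atTop_of_one_div_pow_tendsto_zero {u : ℕ → ℝ} (p : ℕ)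
    (hu : ∀ᶠ k in Filter.atTop, 0 < u k)
    (h : Filter.Tendsto (fun k => 1 / u k ^ p) Filter.atTop (nhds 0)) :
    Filter.Tendsto u Filter.atTop Filter.atTop := by
  refine Filter.tendsto_atTop.2 fun b => ?_
  have hb : (0 : ℝ) < max b 1 := lt_max_of_lt_right one_pos
  filter_upwards [hu, h.eventually_lt_const (one_div_pos.2 (pow_pos hb p))] with k hk hlt
  have hpow := (one_div_lt_one_div (pow_pos hk p) (pow_pos hb p)).1 hlt
  exact (le_max_left b 1).trans (lt_of_pow_lt_pow_left₀ p hk.le hpow).le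

theorem stmt_17 {H : Type*} [NormedAddCommGroup H] [InnerProductSpace ℝ H] [CompleteSpace H]
    (f : H → ℝ) (hf : ConvexOn ℝ Set.univ f) (hbdd : BddBelow (Set.range f))
    (σ θ : ℝ) (hσ0 : 0 ≤ σ) (hσ1 : σ < 1) (hθ : 0 < θ)
    (x : ℕ → H) (v : ℕ → H) (ε lam : ℕ → ℝ)
    (hε : ∀ k, 1 ≤ k → 0 ≤ ε k)
    (hlam : ∀ k, 1 ≤ k → 0 < lam k)
    (hsub : ∀ k, 1 ≤ k → ∀ z : H, f (x k) + ⟪v k, z - x k⟫ - ε k ≤ f z)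
    (herr : ∀ k, 1 ≤ k →
      ‖lam k • v k + x k - x (k - 1)‖ ^ 2 + 2 * lam k * ε k ≤ σ ^ 2 * ‖x k - x (k - 1)‖ ^ 2)
    (hbig : ∀ k, 1 ≤ k → θ ≤ lam k * ‖x k - x (k - 1)‖) :
    Summable (fun k : ℕ => 1 / lam k ^ 3) ∧
    Filter.Tendsto lam Filter.atTop Filter.atTop := by
  have hσ : 0 < 1 - σ ^ 2 := by nlinarith
  have hc : 0 < (1 - σ ^ 2) * θ ^ 2 / 2 := by positivity
  have hsum : Summable (fun k : ℕ => 1 / lam k ^ 3) := by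
    rw [← summable_nat_add_iff 1, ← summable_mul_left_iff hc.ne']
    refine summable_of_le_sub_of_bddBelow (g := fun n => f (x n)) (fun n => ?_) (fun n => ?_)
      (hbdd.mono (Set.range_comp_subset_range x f))
    · have := hlam (n + 1) (by omega)
      positivity
    · have h1 : 1 ≤ n + 1 := by omega
      have hl := hlam (n + 1) h1
      have hdec := inexact_proximal_step_decrease hl (hsub (n + 1) h1 (x (n + 1 - 1)))
        (herr (n + 1) h1)
      have hsq := pow_le_pow_left₀ hθ.le (hbig (n + 1) h1) 2
      simp only [Nat.add_sub_cancel] at hdec hsq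
      rw [mul_one_div, div_le_iff₀ (pow_pos hl 3)]
      calc (1 - σ ^ 2) * θ ^ 2 / 2
          ≤ (1 - σ ^ 2) * (lam (n + 1) * ‖x (n + 1) - x n‖) ^ 2 / 2 := by gcongr
        _ = lam (n + 1) ^ 2 * ((1 - σ ^ 2) * ‖x (n + 1) - x n‖ ^ 2 / 2) := by ring
        _ ≤ lam (n + 1) ^ 2 * (lam (n + 1) * (f (x n) - f (x (n + 1)))) := by gcongr
        _ = (f (x n) - f (x (n + 1))) * lam (n + 1) ^ 3 := by ring
  exact ⟨hsum, tendsto_atTop_of_one_div_pow_tendsto_zero 3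
    (Filter.eventually_atTop.2 ⟨1, hlam⟩) hsum.tendsto_atTop_zero⟩
end

section
/- Let H be a real Hilbert space, f : H → ℝ a convex function, σ ∈ [0, 1), θ > 0, and x₀ ∈ H. Let (x_k)_{k ≥ 0} in H, (v_k)_{k ≥ 1} in H, (ε_k)_{k ≥ 1} and (λ_k)_{k ≥ 1} in ℝ satisfy, for every k ≥ 1: ε_k ≥ 0, λ_k > 0, v_k ∈ ∂_{ε_k} f(x_k), ‖λ_k·v_k + x_k − x_{k−1}‖² + 2λ_k·ε_k ≤ σ²·‖x_k − x_{k−1}‖², and λ_k·‖x_k − x_{k−1}‖ ≥ θ. Let x̄ be a global minimizer of f, and let D₀ > 0 be a real number such that ‖u − w‖ ≤ D₀ whenever f(u) ≤ f(x₀) and f(w) ≤ f(x₀). Set D̂ = D₀·(1 + σ²/(2(1 − σ))) and κ = √(θ·(1 − σ)/D̂³). Then for every k ≥ 1, f(x_k) − f(x̄) ≤ (f(x₀) − f(x̄)) / (1 + k·κ·√(f(x₀) − f(x̄)) / (2 + 3κ·√(f(x₀) − f(x̄))))²; in particular f(x_k) − f(x̄) = O(1/k²). -/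
open RealInnerProductSpace

/-- The displacement and residual bounds satisfied by one inexact proximal step. -/
theorem inexact_prox_step_bounds {H : Type*} [NormedAddCommGroup H] [InnerProductSpace ℝ H]
    {σ l e : ℝ} {d v : H} (hσ0 : 0 ≤ σ) (hl : 0 < l) (he : 0 ≤ e)
    (herr : ‖l • v + d‖ ^ 2 + 2 * l * e ≤ σ ^ 2 * ‖d‖ ^ 2) :
    (1 - σ) * ‖d‖ ≤ l * ‖v‖ ∧ l * ‖v‖ ≤ (1 + σ) * ‖d‖ ∧ 2 * l * e ≤ σ ^ 2 * ‖d‖ ^ 2 ∧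
      (l * ‖v‖) ^ 2 + (1 - σ ^ 2) * ‖d‖ ^ 2 ≤ 2 * l * (-⟪v, d⟫ - e) := by
  have hle : 0 ≤ l * e := by positivity
  have hr : ‖l • v + d‖ ≤ σ * ‖d‖ := by
    refine le_of_sq_le_sq ?_ (by positivity)
    nlinarith
  have hV : ‖l • v‖ = l * ‖v‖ := by rw [norm_smul, Real.norm_of_nonneg hl.le]
  have h1 := norm_sub_le (l • v + d) d
  have h2 := norm_sub_le (l • v + d) (l • v)
  rw [add_sub_cancel_right, hV] at h1
  rw [add_sub_cancel_left, hV] at h2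
  refine ⟨by linarith, by linarith, by nlinarith [sq_nonneg ‖l • v + d‖], ?_⟩
  rw [norm_add_sq_real, hV, real_inner_smul_left] at herr
  nlinarith

/-- A large proximal step decreases the objective by a multiple of the optimality gap to the
power `3 / 2`. -/
theorem gap_decrease_of_large_step {σ θ l D n a p Dhat κ : ℝ} (hσ0 : 0 ≤ σ) (hσ1 : σ < 1)
    (hl : 0 < l) (hD : 0 ≤ D) (hn : 0 ≤ n) (ha : 0 ≤ a)
    (hbig : θ ≤ l * D) (hκ : κ ^ 2 * Dhat ^ 3 = θ * (1 - σ))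
    (hup : l * n ≤ (1 + σ) * D) (han : a ≤ Dhat * n)
    (hp : (l * n) ^ 2 + (1 - σ ^ 2) * D ^ 2 ≤ 2 * l * p) :
    κ * √a ^ 3 ≤ p := by
  have hσ : 0 ≤ 1 - σ := by linarith
  have hσ2 : 0 ≤ 1 - σ ^ 2 := by nlinarith
  have hp0 : 0 ≤ p := by
    have : 0 ≤ 2 * l * p := le_trans (by positivity) hp
    exact nonneg_of_mul_nonneg_right this (by positivity)
  have hamgm : (l * n) ^ 2 * ((1 - σ ^ 2) * D ^ 2) ≤ (l * p) ^ 2 := by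
    have : ((l * n) ^ 2 + (1 - σ ^ 2) * D ^ 2) ^ 2 ≤ (2 * l * p) ^ 2 :=
      pow_le_pow_left₀ (by positivity) hp 2
    nlinarith [sq_nonneg ((l * n) ^ 2 - (1 - σ ^ 2) * D ^ 2)]
  have hcube : κ ^ 2 * a ^ 3 ≤ θ * (1 - σ) * n ^ 3 := by
    calc κ ^ 2 * a ^ 3 ≤ κ ^ 2 * (Dhat * n) ^ 3 := by gcongr
      _ = θ * (1 - σ) * n ^ 3 := by rw [← hκ]; ring
  have hsq : l ^ 2 * (κ ^ 2 * a ^ 3) ≤ l ^ 2 * p ^ 2 := by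
    calc l ^ 2 * (κ ^ 2 * a ^ 3) ≤ l ^ 2 * (θ * (1 - σ) * n ^ 3) := by gcongr
      _ ≤ l ^ 2 * ((l * D) * (1 - σ) * n ^ 3) := by gcongr
      _ = (l * n) ^ 2 * ((1 - σ) * D * (l * n)) := by ring
      _ ≤ (l * n) ^ 2 * ((1 - σ) * D * ((1 + σ) * D)) := by gcongr
      _ = (l * n) ^ 2 * ((1 - σ ^ 2) * D ^ 2) := by ring
      _ ≤ (l * p) ^ 2 := hamgm
      _ = l ^ 2 * p ^ 2 := by ring
  refine le_of_sq_le_sq ?_ hp0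
  calc (κ * √a ^ 3) ^ 2 = κ ^ 2 * (√a ^ 2) ^ 3 := by ring
    _ = κ ^ 2 * a ^ 3 := by rw [Real.sq_sqrt ha]
    _ ≤ p ^ 2 := le_of_mul_le_mul_left hsq (by positivity)

/-- Rate of decay for nonnegative sequences with `b (k + 1) ^ 2 + κ * b (k + 1) ^ 3 ≤ b k ^ 2`. -/
theorem mul_one_add_le_of_cubic_decrease {κ : ℝ} (hκ : 0 ≤ κ) {b : ℕ → ℝ} (hb : ∀ k, 0 ≤ b k)
    (hmono : ∀ k, b k ≤ b 0) (hrec : ∀ k, b (k + 1) ^ 2 + κ * b (k + 1) ^ 3 ≤ b k ^ 2) (k : ℕ) :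
    b k * (1 + k * κ * b 0 / (2 + 3 * κ * b 0)) ≤ b 0 := by
  have h0 := hb 0
  have hden : 0 < 2 + 3 * κ * b 0 := by positivity
  induction k with
  | zero => simp
  | succ k ih =>
    have hβ := hb (k + 1)
    have hβ0 : κ * b (k + 1) ≤ κ * b 0 := mul_le_mul_of_nonneg_left (hmono _) hκ
    set β := b (k + 1)
    have hκβ : 0 ≤ κ * β := by positivity
    set s := √(1 + κ * β)
    have hs2 : s ^ 2 = 1 + κ * β := Real.sq_sqrt (by positivity)
    have hs1 : 1 ≤ s := Real.one_le_sqrt.2 (by linarith)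
    have hstep : β * s ≤ b k := by
      refine le_of_sq_le_sq ?_ (hb k)
      rw [mul_pow, hs2]
      linarith [hrec k]
    set q := κ / (2 + 3 * κ * b 0) with hq
    have hq0 : 0 ≤ q := by positivity
    have hqβ : q * β * s ≤ s - 1 := by
      have h1 : q * (2 + 3 * κ * b 0) = κ := by rw [hq]; field_simp
      have h2 : s * (s + 1) ≤ 2 + 3 * κ * b 0 := by nlinarith [sq_nonneg (s - 1)]
      have h3 : (q * β) * (s * (s + 1)) ≤ (q * β) * (2 + 3 * κ * b 0) := by gcongr
      nlinarith
    have e (j : ℝ) : j * κ * b 0 / (2 + 3 * κ * b 0) = j * q * b 0 := by rw [hq]; ring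
    rw [e] at ih ⊢
    push_cast
    have h4 : β * s * (1 + k * q * b 0) ≤ b 0 :=
      (mul_le_mul_of_nonneg_right hstep (by positivity)).trans ih
    have h5 : q * β * s * b 0 ≤ (s - 1) * b 0 := by gcongr
    exact le_of_mul_le_mul_right (by linarith) (zero_lt_one.trans_le hs1)

theorem stmt_18 {H : Type*} [NormedAddCommGroup H] [InnerProductSpace ℝ H] [CompleteSpace H]
    (f : H → ℝ) (hf : ConvexOn ℝ Set.univ f)
    (σ θ : ℝ) (hσ0 : 0 ≤ σ) (hσ1 : σ < 1) (hθ : 0 < θ)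
    (x : ℕ → H) (v : ℕ → H) (ε lam : ℕ → ℝ)
    (hε : ∀ k, 1 ≤ k → 0 ≤ ε k)
    (hlam : ∀ k, 1 ≤ k → 0 < lam k)
    (hsub : ∀ k, 1 ≤ k → ∀ z : H, f (x k) + ⟪v k, z - x k⟫ - ε k ≤ f z)
    (herr : ∀ k, 1 ≤ k →
      ‖lam k • v k + x k - x (k - 1)‖ ^ 2 + 2 * lam k * ε k ≤ σ ^ 2 * ‖x k - x (k - 1)‖ ^ 2)
    (hbig : ∀ k, 1 ≤ k → θ ≤ lam k * ‖x k - x (k - 1)‖)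
    (xbar : H) (hxbar : ∀ w : H, f xbar ≤ f w)
    (D₀ : ℝ) (hD₀ : 0 < D₀)
    (hdiam : ∀ u w : H, f u ≤ f (x 0) → f w ≤ f (x 0) → ‖u - w‖ ≤ D₀)
    (Dhat κ : ℝ)
    (hDhat : Dhat = D₀ * (1 + σ ^ 2 / (2 * (1 - σ))))
    (hκ : κ = Real.sqrt (θ * (1 - σ) / Dhat ^ 3)) :
    ∀ k : ℕ, 1 ≤ k →
      f (x k) - f xbar ≤
        (f (x 0) - f xbar) /
          (1 + (k : ℝ) * κ * Real.sqrt (f (x 0) - f xbar) /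
            (2 + 3 * κ * Real.sqrt (f (x 0) - f xbar))) ^ 2 := by
  have hσ : 0 < 1 - σ := by linarith
  have hDpos : 0 < Dhat := by rw [hDhat]; positivity
  have hκ0 : 0 ≤ κ := hκ ▸ Real.sqrt_nonneg _
  have hκD : κ ^ 2 * Dhat ^ 3 = θ * (1 - σ) := by
    rw [hκ, Real.sq_sqrt (by positivity)]
    field_simp
  have hstep (k : ℕ) := inexact_prox_step_bounds hσ0 (hlam (k + 1) k.succ_pos)
    (hε (k + 1) k.succ_pos) (d := x (k + 1) - x k) (v := v (k + 1)) (by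
      simpa [add_sub_assoc] using herr (k + 1) k.succ_pos)
  have hdesc (k : ℕ) : -⟪v (k + 1), x (k + 1) - x k⟫ - ε (k + 1) ≤ f (x k) - f (x (k + 1)) := by
    have h := hsub (k + 1) k.succ_pos (x k)
    rw [← neg_sub (x (k + 1)), inner_neg_right] at h
    linarith
  have hanti : Antitone fun k => f (x k) := by
    refine antitone_nat_of_succ_le fun k => ?_
    have hl := hlam (k + 1) k.succ_pos
    obtain ⟨-, -, -, h⟩ := hstep k
    have hσ2 : 0 ≤ 1 - σ ^ 2 := by nlinarith
    have := nonneg_of_mul_nonneg_right (le_trans (by positivity) h)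
      (by positivity : 0 < 2 * lam (k + 1))
    linarith [hdesc k]
  have hle0 (k : ℕ) : f (x k) ≤ f (x 0) := hanti (Nat.zero_le k)
  have hgap (k : ℕ) : f (x (k + 1)) - f xbar ≤ Dhat * ‖v (k + 1)‖ := by
    have hl := hlam (k + 1) k.succ_pos
    obtain ⟨h1, -, h3, -⟩ := hstep k
    have hd := hdiam _ _ (hle0 (k + 1)) (hle0 k)
    have hin : ⟪v (k + 1), x (k + 1) - xbar⟫ ≤ ‖v (k + 1)‖ * D₀ :=
      (real_inner_le_norm _ _).trans
        (mul_le_mul_of_nonneg_left (hdiam _ _ (hle0 _) (hxbar _)) (norm_nonneg _))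
    have hs := hsub (k + 1) k.succ_pos xbar
    rw [← neg_sub (x (k + 1)), inner_neg_right] at hs
    have he : ε (k + 1) * (2 * (1 - σ)) ≤ σ ^ 2 * D₀ * ‖v (k + 1)‖ := by
      refine le_of_mul_le_mul_left ?_ hl
      calc lam (k + 1) * (ε (k + 1) * (2 * (1 - σ)))
          = (2 * lam (k + 1) * ε (k + 1)) * (1 - σ) := by ring
        _ ≤ σ ^ 2 * ‖x (k + 1) - x k‖ ^ 2 * (1 - σ) := by gcongr
        _ = σ ^ 2 * ‖x (k + 1) - x k‖ * ((1 - σ) * ‖x (k + 1) - x k‖) := by ring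
        _ ≤ σ ^ 2 * D₀ * (lam (k + 1) * ‖v (k + 1)‖) := by gcongr
        _ = lam (k + 1) * (σ ^ 2 * D₀ * ‖v (k + 1)‖) := by ring
    rw [← le_div_iff₀ (by positivity)] at he
    calc f (x (k + 1)) - f xbar
        ≤ ‖v (k + 1)‖ * D₀ + σ ^ 2 * D₀ * ‖v (k + 1)‖ / (2 * (1 - σ)) := by linarith
      _ = Dhat * ‖v (k + 1)‖ := by rw [hDhat]; ring
  have hnn (k : ℕ) : 0 ≤ f (x k) - f xbar := sub_nonneg.2 (hxbar _)
  have hrec (k : ℕ) : √(f (x (k + 1)) - f xbar) ^ 2 + κ * √(f (x (k + 1)) - f xbar) ^ 3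
      ≤ √(f (x k) - f xbar) ^ 2 := by
    obtain ⟨-, h2, -, h4⟩ := hstep k
    have h := gap_decrease_of_large_step hσ0 hσ1 (hlam (k + 1) k.succ_pos) (norm_nonneg _)
      (norm_nonneg _) (hnn (k + 1)) (hbig (k + 1) k.succ_pos) hκD h2 (hgap k) h4
    rw [Real.sq_sqrt (hnn _), Real.sq_sqrt (hnn _)]
    linarith [hdesc k]
  intro k _
  have hmain := mul_one_add_le_of_cubic_decrease hκ0 (b := fun k => √(f (x k) - f xbar))
    (fun k => Real.sqrt_nonneg _)
    (fun k => Real.sqrt_le_sqrt (sub_le_sub_right (hle0 k) _)) hrec k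
  rw [le_div_iff₀ (by positivity)]
  calc _ = (√(f (x k) - f xbar) * (1 + k * κ * √(f (x 0) - f xbar) /
            (2 + 3 * κ * √(f (x 0) - f xbar)))) ^ 2 := by rw [mul_pow, Real.sq_sqrt (hnn k)]
    _ ≤ √(f (x 0) - f xbar) ^ 2 := pow_le_pow_left₀ (by positivity) hmain 2
    _ = f (x 0) - f xbar := Real.sq_sqrt (hnn 0)
end

section
/- Let H be a real Hilbert space and f : H → ℝ a differentiable function with gradient ∇f : H → H (i.e., f has gradient ∇f(z) at every z ∈ H). Let x, y ∈ H, λ > 0, σ > 0, L > 0, and let T : H →L[ℝ] H be a continuous linear map such that: λ·(∇f(x) + T(y − x)) + (y − x) = 0 (y is the Newton iterate for the proximal equation λ∇f(·) + · − x = 0 at x), λ·‖y − x‖ ≤ 2σ/L, and ‖∇f(y) − ∇f(x) − T(y − x)‖ ≤ (L/2)·‖y − x‖². Then ‖λ·∇f(y) + y − x‖ ≤ σ·‖y − x‖. -/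
open RealInnerProductSpace

theorem stmt_19 {H : Type*} [NormedAddCommGroup H] [InnerProductSpace ℝ H] [CompleteSpace H]
    (f : H → ℝ) (f' : H → H)
    (hf : ∀ z : H, HasGradientAt f (f' z) z)
    (x y : H) (l σ L : ℝ) (hl : 0 < l) (hσ : 0 < σ) (hL : 0 < L)
    (T : H →L[ℝ] H)
    (hNewton : l • (f' x + T (y - x)) + (y - x) = 0)
    (hstep : l * ‖y - x‖ ≤ 2 * σ / L)
    (hquad : ‖f' y - f' x - T (y - x)‖ ≤ (L / 2) * ‖y - x‖ ^ 2) :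
    ‖l • f' y + y - x‖ ≤ σ * ‖y - x‖ := by
  have key : l • f' y + y - x = l • (f' y - f' x - T (y - x)) := by
    have h : l • f' y + y - x
        = l • (f' y - f' x - T (y - x)) + (l • (f' x + T (y - x)) + (y - x)) := by
      module
    rw [h, hNewton, add_zero]
  have hstep' : l * ‖y - x‖ * L ≤ 2 * σ := (le_div_iff₀ hL).mp hstep
  rw [key, norm_smul, Real.norm_of_nonneg hl.le]
  calc l * ‖f' y - f' x - T (y - x)‖
      ≤ l * ((L / 2) * ‖y - x‖ ^ 2) := by gcongr
    _ = (l * ‖y - x‖ * L / 2) * ‖y - x‖ := by ring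
    _ ≤ σ * ‖y - x‖ := by
      gcongr
      linarith
end
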